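/- arXiv:1505.04646 — 4 statements merged into one kernel-verified Lean document; each statement's English description precedes it below -/
import Mathlib

section
/- If a graph G is 2-connected and has diameter 2, then the proper connection number of G equals 2. -/
/-- An edge-coloring `c` (on unordered pairs of vertices) makes `G` properly connected if every
pair of distinct vertices is joined by a path whose consecutive edges receive different colors. -/
def IsProperPathColoring {V : Type*} (G : SimpleGraph V) (c : Sym2 V → ℕ) : Prop :=
  ∀ u v : V, u ≠ v → ∃ p : G.Walk u v, p.IsPath ∧ (p.edges.map c).Chain' (· ≠ ·)

/-- The proper connection number of `G`: the least `k` such that some edge-coloring using at most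
`k` colors is a proper-path coloring of `G`. -/
noncomputable def properConnectionNumber {V : Type*} (G : SimpleGraph V) : ℕ :=
  sInf {k | ∃ c : Sym2 V → ℕ, (∀ e, c e < k) ∧ IsProperPathColoring G c}

open Relation

/-- If the color of every arc is prescribed by its tail and alternates along arcs, then
consecutive edges of a walk along arcs have different colors. -/
theorem isChain_colors_of_arcs {V : Type*} {G : SimpleGraph V} {c : Sym2 V → ℕ}
    {f : V → ℕ} {R : V → V → Prop} (hR : ∀ u v, R u v → c s(u, v) = f u ∧ f u ≠ f v)
    {u v : V} (p : G.Walk u v) (hp : ∀ d ∈ p.darts, R d.fst d.snd) :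
    (p.edges.map c).IsChain (· ≠ ·) := by
  induction p with
  | nil => simp
  | @cons u v w h p ih =>
    have h1 := hR _ _ (hp ⟨(u, v), h⟩ (by simp))
    have ih' := ih fun d hd => hp d (by simp [hd])
    cases p with
    | nil => simp
    | @cons _ x _ h' q =>
      have h2 := hR _ _ (hp ⟨(v, x), h'⟩ (by simp))
      simp only [SimpleGraph.Walk.edges_cons, List.map_cons, List.isChain_cons_cons] at ih' ⊢
      refine ⟨?_, ih'⟩
      rw [h1.1, h2.1]
      exact h1.2

theorem exists_path_of_reflTransGen {V : Type*} {G : SimpleGraph V} {R : V → V → Prop}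
    (hG : ∀ u v, R u v → G.Adj u v) {u v : V} (h : ReflTransGen R u v) :
    ∃ p : G.Walk u v, p.IsPath ∧ ∀ d ∈ p.darts, R d.fst d.snd := by
  classical
  have : ∃ p : G.Walk u v, ∀ d ∈ p.darts, R d.fst d.snd := by
    induction h using ReflTransGen.head_induction_on with
    | refl => exact ⟨.nil, by simp⟩
    | @head x y hxy _ ih =>
      obtain ⟨p, hp⟩ := ih
      refine ⟨.cons (hG _ _ hxy) p, fun d hd => ?_⟩
      rw [SimpleGraph.Walk.darts_cons, List.mem_cons] at hd
      rcases hd with rfl | hd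
      · exact hxy
      · exact hp d hd
  obtain ⟨p, hp⟩ := this
  exact ⟨p.bypass, p.bypass_isPath, fun d hd => hp d (p.darts_bypass_subset_darts hd)⟩

theorem exists_properPath_symm {V : Type*} {G : SimpleGraph V} {c : Sym2 V → ℕ} {u v : V}
    (h : ∃ p : G.Walk u v, p.IsPath ∧ (p.edges.map c).IsChain (· ≠ ·)) :
    ∃ p : G.Walk v u, p.IsPath ∧ (p.edges.map c).IsChain (· ≠ ·) := by
  obtain ⟨p, hp, hc⟩ := h
  refine ⟨p.reverse, hp.reverse, ?_⟩
  rw [SimpleGraph.Walk.edges_reverse, List.map_reverse, List.isChain_reverse]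
  exact hc.imp fun _ _ h => h.symm

/-- A coloring alternating along the arcs of a unilaterally connected relation inside `G` is a
proper-path coloring. -/
theorem isProperPathColoring_of_unilateral {V : Type*} {G : SimpleGraph V} {c : Sym2 V → ℕ}
    {f : V → ℕ} {R : V → V → Prop} (hG : ∀ u v, R u v → G.Adj u v)
    (hR : ∀ u v, R u v → c s(u, v) = f u ∧ f u ≠ f v)
    (huni : ∀ u v, ReflTransGen R u v ∨ ReflTransGen R v u) : IsProperPathColoring G c := by
  have key : ∀ u v, ReflTransGen R u v →
      ∃ p : G.Walk u v, p.IsPath ∧ (p.edges.map c).IsChain (· ≠ ·) := fun u v h => by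
    obtain ⟨p, hp, hd⟩ := exists_path_of_reflTransGen hG h
    exact ⟨p, hp, isChain_colors_of_arcs hR p hd⟩
  intro u v _
  rcases huni u v with h | h
  · exact key u v h
  · exact exists_properPath_symm (key v u h)

/-- A form of Robbins' theorem: a finite connected symmetric relation has a strongly connected
partial orientation in which only bridges stay bidirected. -/
theorem exists_orientation {V : Type*} [Finite V] {H : V → V → Prop} (hirr : ∀ x, ¬ H x x)
    (hconn : ∀ x y, ReflTransGen H x y) :
    ∃ R : V → V → Prop, (∀ x y, R x y → H x y) ∧ (∀ x y, H x y → R x y ∨ R y x) ∧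
      (∀ x y, ReflTransGen R x y) ∧
      ∀ u v, R u v → R v u →
        ∃ X : Set V, u ∈ X ∧ v ∉ X ∧ ∀ x ∈ X, ∀ y ∉ X, H x y → x = u ∧ y = v := by
  classical
  let S : Set (V → V → Prop) := {R | (∀ x y, R x y → H x y) ∧ (∀ x y, H x y → R x y ∨ R y x) ∧
      ∀ x y, ReflTransGen R x y}
  obtain ⟨R, ⟨hRS, hmin⟩⟩ := (Set.toFinite S).exists_minimal
    ⟨H, fun _ _ h => h, fun _ _ h => Or.inl h, hconn⟩
  obtain ⟨hRH, hHR, hstr⟩ := hRS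
  refine ⟨R, hRH, hHR, hstr, fun u v huv hvu => ?_⟩
  have key : ∀ u v, R u v → R v u →
      ¬ ReflTransGen (fun x y => R x y ∧ ¬ (x = u ∧ y = v)) u v := by
    intro u v huv hvu hreach
    have huv' : u ≠ v := fun h => hirr u (hRH _ _ (h ▸ huv))
    have hmem : (fun x y => R x y ∧ ¬ (x = u ∧ y = v)) ∈ S := by
      refine ⟨fun x y h => hRH _ _ h.1, fun x y h => ?_, fun x y => ?_⟩
      · have := hHR x y h
        grind
      · induction hstr x y with
        | refl => exact .refl
        | @tail b d _ hbc ih =>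
          by_cases h : b = u ∧ d = v
          · obtain ⟨rfl, rfl⟩ := h
            exact ih.trans hreach
          · exact ih.tail ⟨hbc, h⟩
    exact (hmin hmem (fun x y h => h.1) u v huv).2 ⟨rfl, rfl⟩
  set R' : V → V → Prop := fun x y => R x y ∧ ¬ (x = u ∧ y = v) ∧ ¬ (x = v ∧ y = u)
  have n1 : ¬ ReflTransGen R' u v := fun h =>
    key u v huv hvu (ReflTransGen.mono (fun x y h => ⟨h.1, h.2.1⟩) _ _ h)
  have n2 : ¬ ReflTransGen R' v u := fun h =>
    key v u hvu huv (ReflTransGen.mono (fun x y h => ⟨h.1, h.2.2⟩) _ _ h)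
  refine ⟨{x | ReflTransGen R' u x}, .refl, n1, fun x hx y hy hxy => ?_⟩
  simp only [Set.mem_ofPred_eq] at hx hy
  by_contra hne
  have hxv : x ≠ v := fun h => n1 (h ▸ hx)
  have hyu : y ≠ u := fun h => hy (h ▸ .refl)
  rcases hHR x y hxy with h | h
  · exact hy (hx.tail ⟨h, hne, fun h => hxv h.1⟩)
  · have hyx : R' y x := ⟨h, fun h => hyu h.1, fun h => hne ⟨h.2, h.1⟩⟩
    have h1 : ∀ z, ReflTransGen R' u z ∨ ReflTransGen R' v z := by
      intro z
      induction hstr u z with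
      | refl => exact .inl .refl
      | @tail b d _ hbc ih =>
        by_cases e1 : b = u ∧ d = v
        · exact .inr (e1.2 ▸ .refl)
        by_cases e2 : b = v ∧ d = u
        · exact .inl (e2.2 ▸ .refl)
        exact ih.imp (fun h => h.tail ⟨hbc, e1, e2⟩) fun h => h.tail ⟨hbc, e1, e2⟩
    have h2 : ∀ z, ReflTransGen R' x z ∨ ReflTransGen R' x u := by
      intro z
      induction hstr x z with
      | refl => exact .inl .refl
      | @tail b d _ hbc ih =>
        rcases ih with ih | ih
        · by_cases e1 : b = u ∧ d = v
          · exact .inr (e1.1 ▸ ih)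
          by_cases e2 : b = v ∧ d = u
          · exact absurd (hx.trans (e2.1 ▸ ih)) n1
          exact .inl (ih.tail ⟨hbc, e1, e2⟩)
        · exact .inr ih
    have hvx := ((h1 y).resolve_left hy).tail hyx
    rcases h2 v with h | h
    · exact n1 (hx.trans h)
    · exact n2 (hvx.trans h)

open Classical in
/-- A maximum weighted cut carries at least half of the weight of every cut. -/
theorem exists_max_cut {V : Type*} [Fintype V] (w : V → V → ℤ) (hw : ∀ x y, w x y = w y x) :
    ∃ s : V → ℤˣ, ∀ X : Set V,
      ∑ e : V × V, (if e.1 ∈ X ∧ e.2 ∉ X then w e.1 e.2 * (s e.1 * s e.2 : ℤˣ) else 0) ≤ 0 := by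
  obtain ⟨s, hs⟩ := Finite.exists_min
    fun s : V → ℤˣ => ∑ e : V × V, w e.1 e.2 * (s e.1 * s e.2 : ℤˣ)
  refine ⟨s, fun X => ?_⟩
  have h := hs fun x => if x ∈ X then -s x else s x
  have hswap : ∑ e : V × V, (if e.1 ∈ X ∧ e.2 ∉ X then w e.1 e.2 * (s e.1 * s e.2 : ℤˣ) else 0)
      = ∑ e : V × V,
        (if e.2 ∈ X ∧ e.1 ∉ X then w e.1 e.2 * ((s e.1 * s e.2 : ℤˣ) : ℤ) else 0) := by
    rw [← Equiv.sum_comp (Equiv.prodComm V V)]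
    refine Finset.sum_congr rfl fun e _ => ?_
    simp only [Equiv.prodComm_apply, Prod.fst_swap, Prod.snd_swap]
    rw [hw, mul_comm (s e.2)]
    congr
  have hdiff : ∑ e : V × V, w e.1 e.2 * ((s e.1 * s e.2 : ℤˣ) : ℤ) =
      ∑ e : V × V, w e.1 e.2 * (((if e.1 ∈ X then -s e.1 else s e.1) *
          (if e.2 ∈ X then -s e.2 else s e.2) : ℤˣ) : ℤ) +
      (2 * ∑ e : V × V,
        (if e.1 ∈ X ∧ e.2 ∉ X then w e.1 e.2 * ((s e.1 * s e.2 : ℤˣ) : ℤ) else 0) +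
      2 * ∑ e : V × V,
        (if e.2 ∈ X ∧ e.1 ∉ X then w e.1 e.2 * ((s e.1 * s e.2 : ℤˣ) : ℤ) else 0)) := by
    rw [Finset.mul_sum, Finset.mul_sum, ← Finset.sum_add_distrib, ← Finset.sum_add_distrib]
    refine Finset.sum_congr rfl fun e _ => ?_
    by_cases h1 : e.1 ∈ X <;> by_cases h2 : e.2 ∈ X <;> simp [h1, h2] <;> ring
  linarith

open Classical in
theorem sum_le_of_cut_sum_nonpos {V : Type*} [Fintype V] {w : V → V → ℤ} {s : V → ℤˣ} {X : Set V}
    (hsum : ∑ e : V × V,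
      (if e.1 ∈ X ∧ e.2 ∉ X then w e.1 e.2 * (s e.1 * s e.2 : ℤˣ) else 0) ≤ 0)
    (hw : ∀ x y, 0 ≤ w x y) {u v : V}
    (honly : ∀ x ∈ X, ∀ y ∉ X, 0 < w x y → s x ≠ s y → x = u ∧ y = v)
    (T : Finset (V × V)) (hT : ∀ e ∈ T, e.1 ∈ X ∧ e.2 ∉ X ∧ s e.1 = s e.2) :
    ∑ e ∈ T, w e.1 e.2 ≤ if s u = s v then 0 else w u v := by
  set b : ℤ := if s u = s v then 0 else w u v with hb
  have hb0 : 0 ≤ b := by rw [hb]; split_ifs; exacts [le_rfl, hw u v]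
  let f : V × V → ℤ := fun e =>
    if e.1 ∈ X ∧ e.2 ∉ X then w e.1 e.2 * (s e.1 * s e.2 : ℤˣ) else 0
  let g : V × V → ℤ := fun e => f e + if e = (u, v) then b else 0
  have hone : ∀ e : V × V, s e.1 = s e.2 → ((s e.1 * s e.2 : ℤˣ) : ℤ) = 1 := fun e h => by
    rw [h, Int.units_mul_self]; rfl
  have hneg : ∀ e : V × V, s e.1 ≠ s e.2 → ((s e.1 * s e.2 : ℤˣ) : ℤ) = -1 := fun e h => by
    rcases Int.units_eq_one_or (s e.1) with h1 | h1 <;>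
      rcases Int.units_eq_one_or (s e.2) with h2 | h2 <;> simp_all
  have hg : ∀ e, 0 ≤ g e := by
    intro e
    have hi : 0 ≤ if e = (u, v) then b else 0 := by split_ifs; exacts [hb0, le_rfl]
    by_cases hX : e.1 ∈ X ∧ e.2 ∉ X
    · by_cases hs : s e.1 = s e.2
      · have : f e = w e.1 e.2 := by simp only [f, if_pos hX, hone e hs, mul_one]
        have := hw e.1 e.2
        simp only [g]; linarith
      · have hf : f e = - w e.1 e.2 := by simp only [f, if_pos hX, hneg e hs]; ring
        rcases (hw e.1 e.2).eq_or_lt with h0 | h0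
        · simp only [g]; linarith
        · obtain ⟨h1, h2⟩ := honly e.1 hX.1 e.2 hX.2 h0 hs
          obtain ⟨x, y⟩ := e
          simp only at h1 h2 hs
          subst h1 h2
          simp only [g, hf, hb, if_neg hs, if_true]
          simp
    · simp only [g, f, if_neg hX]; linarith
  calc ∑ e ∈ T, w e.1 e.2 ≤ ∑ e ∈ T, g e := by
        refine Finset.sum_le_sum fun e he => ?_
        obtain ⟨h1, h2, h3⟩ := hT e he
        simp only [g, f, if_pos (And.intro h1 h2), hone e h3, mul_one]
        split_ifs <;> linarith
    _ ≤ ∑ e, g e := Finset.sum_le_univ_sum_of_nonneg hg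
    _ = ∑ e, f e + b := by simp [g, Finset.sum_add_distrib]
    _ ≤ b := by linarith [show ∑ e, f e ≤ 0 from hsum]

/-- The neighborhood of the vertex is contained in a set of at most two vertices. -/
def HasAtMostTwoNeighbors {V : Type*} (G : SimpleGraph V) (d : V) : Prop :=
  ∃ p q, ∀ x, G.Adj d x → x = p ∨ x = q

section

variable {V : Type*} {G : SimpleGraph V}

theorem exists_adj_iff_eq_or_eq (hdeg : ∀ v w, ∃ y, y ≠ w ∧ G.Adj v y) {d p : V}
    (hd : HasAtMostTwoNeighbors G d) (hp : G.Adj d p) :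
    ∃ q, q ≠ p ∧ ∀ x, G.Adj d x ↔ x = p ∨ x = q := by
  obtain ⟨s, t, hst⟩ := hd
  obtain ⟨q, hqp, hq⟩ := hdeg d p
  refine ⟨q, hqp, fun x => ⟨fun hx => ?_, ?_⟩⟩
  · have h1 := hst p hp
    have h2 := hst q hq
    have h3 := hst x hx
    grind
  · rintro (rfl | rfl)
    exacts [hp, hq]

theorem eq_singleton_of_small_side (hdeg : ∀ v w, ∃ y, y ≠ w ∧ G.Adj v y)
    (hind : ∀ d d', HasAtMostTwoNeighbors G d → HasAtMostTwoNeighbors G d' → ¬ G.Adj d d')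
    {X : Set V} {u v p q : V} (hu : u ∈ X)
    (hcross : ∀ x ∈ X, ∀ y ∉ X, G.Adj x y → (x = u ∧ y = v) ∨ (x = p ∧ y = q))
    (hX : ∀ x ∈ X, x = u ∨ x = p) : X = {u} ∧ HasAtMostTwoNeighbors G u := by
  by_cases hp : p ∈ X ∧ p ≠ u
  · have h1 : HasAtMostTwoNeighbors G p := ⟨u, q, fun x hx => by
      by_cases hxX : x ∈ X
      · rcases hX x hxX with h | h
        · exact .inl h
        · exact absurd hx (h ▸ G.irrefl)
      · have := hcross p hp.1 x hxX hx
        grind⟩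
    have h2 : HasAtMostTwoNeighbors G u := ⟨p, v, fun x hx => by
      by_cases hxX : x ∈ X
      · rcases hX x hxX with h | h
        · exact absurd hx (h ▸ G.irrefl)
        · exact .inl h
      · have := hcross u hu x hxX hx
        grind⟩
    obtain ⟨y, hy, hpy⟩ := hdeg p q
    have : y = u := by
      by_cases hyX : y ∈ X
      · rcases hX y hyX with h | h
        · exact h
        · exact absurd hpy (h ▸ G.irrefl)
      · have := hcross p hp.1 y hyX hpy
        grind
    exact absurd (this ▸ hpy) (hind p u h1 h2)
  · have hXu : X = {u} := by
      ext x
      refine ⟨fun h => ?_, fun h => h ▸ hu⟩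
      have := hX x h
      simp only [Set.mem_singleton_iff]
      grind
    refine ⟨hXu, v, q, fun x hx => ?_⟩
    have hxX : x ∉ X := by
      rw [hXu]
      rintro rfl
      exact G.irrefl hx
    have := hcross u hu x hxX hx
    grind

open Classical in
/-- Weights that favor the edges joining `a` to vertices with at most two neighbors. -/
noncomputable def starWeight (G : SimpleGraph V) (a x y : V) : ℤ :=
  if G.Adj x y then
    if (x = a ∧ HasAtMostTwoNeighbors G y) ∨ (y = a ∧ HasAtMostTwoNeighbors G x) then 3 else 2
  else 0

theorem starWeight_comm (a x y : V) : starWeight G a x y = starWeight G a y x := by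
  unfold starWeight
  grind [G.adj_comm x y]

theorem starWeight_nonneg (a x y : V) : 0 ≤ starWeight G a x y := by
  unfold starWeight; split_ifs <;> norm_num

theorem starWeight_le (a x y : V) : starWeight G a x y ≤ 3 := by
  unfold starWeight; split_ifs <;> norm_num

theorem two_le_starWeight {a x y : V} (h : G.Adj x y) : 2 ≤ starWeight G a x y := by
  unfold starWeight; split_ifs <;> norm_num

theorem exists_bridge_leaf_of_cut [Fintype V]
    (hdeg : ∀ v w, ∃ y, y ≠ w ∧ G.Adj v y) (hconn : G.Connected)
    (hdist : ∀ x y, x = y ∨ G.Adj x y ∨ ∃ z, G.Adj x z ∧ G.Adj z y)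
    (hind : ∀ d d', HasAtMostTwoNeighbors G d → HasAtMostTwoNeighbors G d' → ¬ G.Adj d d')
    {a : V} (ha : ∀ d, HasAtMostTwoNeighbors G d → G.Adj a d) :
    ∃ s : V → ℤˣ, ∀ (X : Set V) (u v : V), u ∈ X → v ∉ X →
      (∀ x ∈ X, ∀ y ∉ X, G.Adj x y → s x ≠ s y → x = u ∧ y = v) →
      G.Adj u v ∧ s u ≠ s v ∧
        ((X = {u} ∧ HasAtMostTwoNeighbors G u ∧ v = a) ∨
          (Xᶜ = {v} ∧ HasAtMostTwoNeighbors G v ∧ u = a)) := by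
  classical
  obtain ⟨s, hs⟩ := exists_max_cut (starWeight G a) (starWeight_comm a)
  refine ⟨s, fun X u v hu hv honly => ?_⟩
  have hbound := sum_le_of_cut_sum_nonpos (hs X) (starWeight_nonneg a) (u := u) (v := v)
    fun x hx y hy hw hxy => honly x hx y hy (by
      by_contra h
      simp [starWeight, h] at hw) hxy
  have hsingle : ∀ x ∈ X, ∀ y ∉ X, s x = s y →
      starWeight G a x y ≤ if s u = s v then 0 else starWeight G a u v := fun x hx y hy hxy => by
    simpa using hbound {(x, y)} (by simp [hx, hy, hxy])
  have hpair : ∀ x ∈ X, ∀ y ∉ X, s x = s y → G.Adj x y →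
      ∀ x' ∈ X, ∀ y' ∉ X, s x' = s y' → G.Adj x' y' → x' = x ∧ y' = y := by
    intro x hx y hy hxy hadj x' hx' y' hy' hxy' hadj'
    by_contra hne
    have hne' : (x, y) ≠ (x', y') := by
      intro h
      rw [Prod.mk.injEq] at h
      exact hne ⟨h.1.symm, h.2.symm⟩
    have h := hbound {(x, y), (x', y')} (by simp [hx, hy, hxy, hx', hy', hxy'])
    rw [Finset.sum_pair hne'] at h
    have h1 := two_le_starWeight (a := a) hadj
    have h2 := two_le_starWeight (a := a) hadj'
    have h3 := starWeight_le (G := G) a u v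
    simp only at h
    split_ifs at h <;> linarith
  have hH : G.Adj u v ∧ s u ≠ s v := by
    obtain ⟨x, hx, y, hy, hxy⟩ : ∃ x ∈ X, ∃ y ∉ X, G.Adj x y := by
      obtain ⟨p⟩ := hconn.preconnected u v
      obtain ⟨d, -, h1, h2⟩ := p.exists_boundary_dart X hu hv
      exact ⟨d.fst, h1, d.snd, h2, d.adj⟩
    by_cases hs' : s x = s y
    · have h1 := hsingle x hx y hy hs'
      have h2 := two_le_starWeight (a := a) hxy
      constructor
      · by_contra h
        simp only [starWeight, if_neg h, ite_self] at h1 h2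
        linarith
      · intro h
        rw [if_pos h] at h1
        linarith
    · obtain ⟨rfl, rfl⟩ := honly x hx y hy hxy hs'
      exact ⟨hxy, hs'⟩
  refine ⟨hH.1, hH.2, ?_⟩
  obtain ⟨p, q, hcross⟩ : ∃ p q, ∀ x ∈ X, ∀ y ∉ X, G.Adj x y →
      (x = u ∧ y = v) ∨ (x = p ∧ y = q) := by
    by_cases h : ∃ p ∈ X, ∃ q ∉ X, G.Adj p q ∧ s p = s q
    · obtain ⟨p, hp, q, hq, hpq, hspq⟩ := h
      refine ⟨p, q, fun x hx y hy hxy => ?_⟩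
      by_cases hsxy : s x = s y
      · exact .inr (hpair p hp q hq hspq hpq x hx y hy hsxy hxy)
      · exact .inl (honly x hx y hy hxy hsxy)
    · refine ⟨u, v, fun x hx y hy hxy => .inl (honly x hx y hy hxy fun hsxy => ?_)⟩
      exact h ⟨x, hx, y, hy, hxy, hsxy⟩
  have haD : ¬ HasAtMostTwoNeighbors G a := fun h => G.irrefl (ha a h)
  have hsmall : (∀ x ∈ X, x = u ∨ x = p) ∨ ∀ y ∉ X, y = v ∨ y = q := by
    by_contra! h
    obtain ⟨⟨x, hx, hxu, hxp⟩, y, hy, hyv, hyq⟩ := h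
    rcases hdist x y with h | h | ⟨z, h1, h2⟩
    · exact hy (h ▸ hx)
    · have := hcross x hx y hy h
      tauto
    · by_cases hz : z ∈ X
      · have := hcross z hz y hy h2
        tauto
      · have := hcross x hx z hz h1
        tauto
  rw [if_neg hH.2] at hsingle
  rcases hsmall with h | h
  · obtain ⟨hX, hD⟩ := eq_singleton_of_small_side hdeg hind hu hcross h
    refine .inl ⟨hX, hD, ?_⟩
    by_contra hva
    have hau := (ha u hD).symm
    have hua : u ≠ a := hau.ne
    have haX : a ∉ X := by
      rw [hX]
      exact hua.symm
    have hsua : s u = s a := by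
      by_contra h
      exact hva (honly u hu a haX hau h).2.symm
    have h1 := hsingle u hu a haX hsua
    simp [starWeight, hau, hD, hH.1, hva, hua] at h1
  · obtain ⟨hX, hD⟩ := eq_singleton_of_small_side (X := Xᶜ) (v := u) (q := p) hdeg hind hv
      (fun x hx y hy hxy => by
        have := hcross y (by simpa using hy) x hx hxy.symm
        tauto) h
    refine .inr ⟨hX, hD, ?_⟩
    by_contra hua
    have hav := ha v hD
    have hva : v ≠ a := hav.ne.symm
    have haX : a ∈ X := by
      by_contra h
      have : a ∈ Xᶜ := h
      rw [hX] at this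
      exact hva this.symm
    have hsva : s a = s v := by
      by_contra h
      exact hua (honly a haX v hv hav h).1.symm
    have h1 := hsingle a haX v hv hsva
    simp [starWeight, hav, hD, hH.1, hva, hua] at h1

/-- If the vertices with at most two neighbors are independent and share a neighbor, a graph of
diameter two has a proper-path coloring with two colors. -/
theorem exists_coloring_of_common_neighbor [Fintype V]
    (hdeg : ∀ v w, ∃ y, y ≠ w ∧ G.Adj v y) (hconn : G.Connected)
    (hdist : ∀ x y, x = y ∨ G.Adj x y ∨ ∃ z, G.Adj x z ∧ G.Adj z y)
    (hind : ∀ d d', HasAtMostTwoNeighbors G d → HasAtMostTwoNeighbors G d' → ¬ G.Adj d d')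
    {a : V} (ha : ∀ d, HasAtMostTwoNeighbors G d → G.Adj a d) :
    ∃ c : Sym2 V → ℕ, (∀ e, c e < 2) ∧ IsProperPathColoring G c := by
  classical
  obtain ⟨s, hs⟩ := exists_bridge_leaf_of_cut hdeg hconn hdist hind ha
  have haD : ¬ HasAtMostTwoNeighbors G a := fun h => G.irrefl (ha a h)
  let H : V → V → Prop := fun x y => G.Adj x y ∧ s x ≠ s y
  have Hsymm : ∀ {x y}, H x y → H y x := fun h => ⟨h.1.symm, h.2.symm⟩
  have Hconn : ∀ x y, ReflTransGen H x y := by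
    intro x y
    by_contra h
    have := hs {z | ReflTransGen H x z} x y .refl h fun z hz t ht hzt hst =>
      absurd (ReflTransGen.tail hz ⟨hzt, hst⟩) ht
    exact h (.single ⟨this.1, this.2.1⟩)
  obtain ⟨R, hRH, hHR, hstr, hbridge⟩ := exists_orientation (fun x h => h.2 rfl) Hconn
  let L : V → Prop := fun d => HasAtMostTwoNeighbors G d ∧ ∀ y, H d y → y = a
  have hbi : ∀ u v, R u v → R v u → (L u ∧ v = a) ∨ (L v ∧ u = a) := by
    intro u v huv hvu
    obtain ⟨X, hu, hv, hX⟩ := hbridge u v huv hvu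
    obtain ⟨-, -, ⟨h1, h2, h3⟩ | ⟨h1, h2, h3⟩⟩ :=
      hs X u v hu hv fun x hx y hy hxy hsxy => hX x hx y hy ⟨hxy, hsxy⟩
    · refine .inl ⟨⟨h2, fun y hy => ?_⟩, h3⟩
      have hyX : y ∉ X := by
        rw [h1]
        rintro rfl
        exact hy.2 rfl
      exact (hX u hu y hyX hy).2.trans h3
    · refine .inr ⟨⟨h2, fun y hy => ?_⟩, h3⟩
      have hyX : y ∈ X := by
        by_contra h
        have : y ∈ Xᶜ := h
        rw [h1] at this
        exact hy.2 (this ▸ rfl)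
      exact (hX y hyX v hv (Hsymm hy)).1.trans h3
  let R' : V → V → Prop := fun x y => R x y ∧ ¬ L x
  have hreach : ∀ u v, ¬ L u → ReflTransGen R' u v := by
    intro u v hu
    induction hstr u v with
    | refl => exact .refl
    | @tail x y _ hxy ih =>
      by_cases hx : L x
      · rcases ih.cases_tail with h | ⟨t, ht, htx⟩
        · exact absurd (h ▸ hx) hu
        · have h1 := hx.2 t (Hsymm (hRH _ _ htx.1))
          have h2 := hx.2 y (hRH _ _ hxy)
          exact h2.trans h1.symm ▸ ht
      · exact ih.tail ⟨hxy, hx⟩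
  let c : Sym2 V → ℕ := fun e =>
    if ∃ x y, e = s(x, y) ∧ s x = s a ∧ s y ≠ s a ∧ ¬ R x y then 1 else 0
  let f : V → ℕ := fun x => if s x = s a then 0 else 1
  have two : ∀ x y z, s x ≠ s y → s y ≠ s z → s x = s z := fun x y z h1 h2 => by
    rcases Int.units_eq_one_or (s x) with h | h <;> rcases Int.units_eq_one_or (s y) with h' | h' <;>
      rcases Int.units_eq_one_or (s z) with h'' | h'' <;> simp_all
  have hR' : ∀ u v, R' u v → c s(u, v) = f u ∧ f u ≠ f v := by
    intro u v huv
    have hne := (hRH _ _ huv.1).2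
    by_cases hu : s u = s a
    · have hv : s v ≠ s a := fun h => hne (hu.trans h.symm)
      refine ⟨?_, by simp [f, hu, hv]⟩
      simp only [c, f, if_pos hu]
      refine if_neg ?_
      rintro ⟨x, y, hxy, hx, hy, hn⟩
      rcases Sym2.eq_iff.1 hxy with ⟨rfl, rfl⟩ | ⟨rfl, rfl⟩
      · exact hn huv.1
      · exact hv hx
    · have hv : s v = s a := two v u a hne.symm hu
      refine ⟨?_, by simp [f, hu, hv]⟩
      simp only [c, f, if_neg hu]
      refine if_pos ⟨v, u, Sym2.eq_swap, hv, hu, fun h => ?_⟩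
      rcases hbi u v huv.1 h with h | h
      · exact huv.2 h.1
      · exact hu (h.2 ▸ rfl)
  have hR'G : ∀ u v, R' u v → G.Adj u v := fun u v h => (hRH _ _ h.1).1
  have key : ∀ u v, ¬ L u →
      ∃ p : G.Walk u v, p.IsPath ∧ (p.edges.map c).IsChain (· ≠ ·) := fun u v h => by
    obtain ⟨p, hp, hd⟩ := exists_path_of_reflTransGen hR'G (hreach u v h)
    exact ⟨p, hp, isChain_colors_of_arcs hR' p hd⟩
  refine ⟨c, fun e => ?_, fun u v huv => ?_⟩
  · simp only [c]
    split_ifs <;> norm_num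
  by_cases hu : L u
  swap
  · exact key u v hu
  by_cases hv : L v
  swap
  · exact exists_properPath_symm (key v u hv)
  obtain ⟨b, hba, hub⟩ := hdeg u a
  have hbL : ¬ L b := fun h => hind u b hu.1 h.1 hub
  have hsub : s u = s b := by
    by_contra h
    exact hba (hu.2 b ⟨hub, h⟩)
  have hsu : s u ≠ s a := by
    rcases (hstr u a).cases_head with h | ⟨t, ht, -⟩
    · exact absurd (h ▸ hu.1) haD
    · have := hRH _ _ ht
      have h2 := hu.2 t this
      exact h2 ▸ this.2
  have hsb : s b ≠ s a := hsub ▸ hsu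
  obtain ⟨p, hp, hd⟩ := exists_path_of_reflTransGen hR'G (hreach b v hbL)
  have hnotin : u ∉ p.support := by
    intro h
    rw [← p.map_fst_darts_append, List.mem_append, List.mem_map, List.mem_singleton] at h
    rcases h with ⟨d, hdp, rfl⟩ | h
    · exact (hd d hdp).2 hu
    · exact huv h
  suffices h : ((SimpleGraph.Walk.cons hub p).edges.map c).IsChain (· ≠ ·) from
    ⟨.cons hub p, hp.cons hnotin, h⟩
  have hchain := isChain_colors_of_arcs hR' p hd
  cases p with
  | nil => simp
  | @cons _ x _ h' q =>
    have h2 := hR' _ _ (hd ⟨(b, x), h'⟩ (by simp))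
    simp only [SimpleGraph.Walk.edges_cons, List.map_cons, List.isChain_cons_cons] at hchain ⊢
    refine ⟨?_, hchain⟩
    have h0 : c s(u, b) = 0 := by
      refine if_neg ?_
      rintro ⟨x, y, hxy, hx, hy, hn⟩
      rcases Sym2.eq_iff.1 hxy with ⟨rfl, rfl⟩ | ⟨rfl, rfl⟩
      · exact hsu hx
      · exact hsb hx
    rw [h0, h2.1]
    simp [f, hsb]

theorem exists_coloring_of_triangle {a b c u v w : V}
    (hdist : ∀ x y, x = y ∨ G.Adj x y ∨ ∃ z, G.Adj x z ∧ G.Adj z y)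
    (hab : a ≠ b) (hbc : b ≠ c) (hac : a ≠ c) (huc : u ≠ c) (hva : v ≠ a) (hwb : w ≠ b)
    (hu : ∀ x, G.Adj u x ↔ x = a ∨ x = b) (hv : ∀ x, G.Adj v x ↔ x = b ∨ x = c)
    (hw : ∀ x, G.Adj w x ↔ x = c ∨ x = a) :
    ∃ c : Sym2 V → ℕ, (∀ e, c e < 2) ∧ IsProperPathColoring G c := by
  classical
  have hdom : ∀ {d p q : V}, (∀ x, G.Adj d x ↔ x = p ∨ x = q) → ∀ z, z ≠ p → z ≠ q →
      G.Adj p z ∨ G.Adj q z := by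
    intro d p q hd z hp hq
    rcases hdist d z with rfl | h | ⟨t, h1, h2⟩
    · exact .inl (((hd p).2 (.inl rfl)).symm)
    · rcases (hd z).1 h with h | h
      · exact absurd h hp
      · exact absurd h hq
    · rcases (hd t).1 h1 with rfl | rfl
      · exact .inl h2
      · exact .inr h2
  have hua : G.Adj u a := (hu a).2 (.inl rfl)
  have hub : G.Adj u b := (hu b).2 (.inr rfl)
  have hvb : G.Adj v b := (hv b).2 (.inl rfl)
  have hvc : G.Adj v c := (hv c).2 (.inr rfl)
  have hwc : G.Adj w c := (hw c).2 (.inl rfl)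
  have hwa : G.Adj w a := (hw a).2 (.inr rfl)
  let S : V → Prop := fun x => x = a ∨ x = b ∨ x = c
  have huv : u ≠ v := by
    rintro rfl
    have := (hu c).1 hvc
    grind
  have huw : u ≠ w := by
    rintro rfl
    have := (hu c).1 hwc
    grind
  have hvw : v ≠ w := by
    rintro rfl
    have := (hv a).1 hwa
    grind
  have hch : ∀ z, ∃ i o, ¬ S z → S i ∧ S o ∧ i ≠ o ∧ G.Adj i z ∧ G.Adj z o ∧
      (z = u → i = a ∧ o = b) ∧ (z = v → i = b ∧ o = c) ∧ (z = w → i = c ∧ o = a) := by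
    intro z
    by_cases hS : S z
    · exact ⟨z, z, fun h => absurd hS h⟩
    by_cases h1 : z = u
    · exact ⟨a, b, fun _ => by subst h1; simp [S, hab, hua.symm, hub, huv, huw]⟩
    by_cases h2 : z = v
    · exact ⟨b, c, fun _ => by subst h2; simp [S, hbc, hvb.symm, hvc, huv.symm, hvw]⟩
    by_cases h3 : z = w
    · exact ⟨c, a, fun _ => by subst h3; simp [S, hac.symm, hwc.symm, hwa, huw.symm, hvw.symm]⟩
    have hza : z ≠ a := fun h => hS (.inl h)
    have hzb : z ≠ b := fun h => hS (.inr (.inl h))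
    have hzc : z ≠ c := fun h => hS (.inr (.inr h))
    have d1 := hdom hu z hza hzb
    have d2 := hdom hv z hzb hzc
    have d3 := hdom hw z hzc hza
    by_cases ka : G.Adj a z
    · by_cases kb : G.Adj b z
      · exact ⟨a, b, fun _ => by simp [S, h1, h2, h3, ka, kb.symm, hab]⟩
      · have kc := d2.resolve_left kb
        exact ⟨a, c, fun _ => by simp [S, h1, h2, h3, ka, kc.symm, hac]⟩
    · have kb := d1.resolve_left ka
      have kc := d3.resolve_right ka
      exact ⟨b, c, fun _ => by simp [S, h1, h2, h3, kb, kc.symm, hbc]⟩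
  choose i o hio using hch
  let R : V → V → Prop := fun x y => (¬ S y ∧ x = i y) ∨ (¬ S x ∧ y = o x)
  have hSu : ¬ S u := by
    rintro (h | h | h)
    exacts [hua.ne h, hub.ne h, huc h]
  have hSv : ¬ S v := by
    rintro (h | h | h)
    exacts [hva h, hvb.ne h, hvc.ne h]
  have hSw : ¬ S w := by
    rintro (h | h | h)
    exacts [hwa.ne h, hwb h, hwc.ne h]
  have step : ∀ z, ¬ S z → ReflTransGen R (i z) (o z) := fun z hz =>
    .tail (.single (.inl ⟨hz, rfl⟩)) (.inr ⟨hz, rfl⟩)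
  have rab : ReflTransGen R a b := by
    have h := (hio u hSu).2.2.2.2.2.1 rfl
    exact h.1 ▸ h.2 ▸ step u hSu
  have rbc : ReflTransGen R b c := by
    have h := (hio v hSv).2.2.2.2.2.2.1 rfl
    exact h.1 ▸ h.2 ▸ step v hSv
  have rca : ReflTransGen R c a := by
    have h := (hio w hSw).2.2.2.2.2.2.2 rfl
    exact h.1 ▸ h.2 ▸ step w hSw
  have toa : ∀ x, ReflTransGen R x a := by
    have hS : ∀ x, S x → ReflTransGen R x a := by
      rintro x (rfl | rfl | rfl)
      exacts [.refl, rbc.trans rca, rca]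
    intro x
    by_cases hx : S x
    · exact hS x hx
    · exact .head (.inr ⟨hx, rfl⟩) (hS _ (hio x hx).2.1)
  have froma : ∀ x, ReflTransGen R a x := by
    have hS : ∀ x, S x → ReflTransGen R a x := by
      rintro x (rfl | rfl | rfl)
      exacts [.refl, rab, rab.trans rbc]
    intro x
    by_cases hx : S x
    · exact hS x hx
    · exact .tail (hS _ (hio x hx).1) (.inl ⟨hx, rfl⟩)
  refine ⟨fun e => if ∃ z, ¬ S z ∧ e = s(z, o z) then 1 else 0, fun e => ?_,
    isProperPathColoring_of_unilateral (R := R) (f := fun x => if S x then 0 else 1) ?_ ?_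
      fun x y => .inl ((toa x).trans (froma y))⟩
  · dsimp only
    split_ifs <;> norm_num
  · rintro x y (⟨h, rfl⟩ | ⟨h, rfl⟩)
    · exact (hio y h).2.2.2.1
    · exact (hio x h).2.2.2.2.1
  · rintro x y (⟨h, rfl⟩ | ⟨h, rfl⟩)
    · have hi := (hio y h).1
      refine ⟨?_, by simp [hi, h]⟩
      rw [if_pos hi]
      refine if_neg ?_
      rintro ⟨z, hz, hzz⟩
      rcases Sym2.eq_iff.1 hzz with ⟨h1, -⟩ | ⟨h1, rfl⟩
      · exact hz (h1 ▸ hi)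
      · exact (hio y h).2.2.1 h1
    · have ho := (hio x h).2.1
      refine ⟨?_, by simp [ho, h]⟩
      rw [if_neg h]
      exact if_pos ⟨x, h, rfl⟩

theorem exists_coloring_of_adj {x y p q : V}
    (hdeg : ∀ v w, ∃ y, y ≠ w ∧ G.Adj v y)
    (hdist : ∀ x y, x = y ∨ G.Adj x y ∨ ∃ z, G.Adj x z ∧ G.Adj z y)
    (hpq : p ≠ q) (hx : ∀ t, G.Adj x t ↔ t = p ∨ t = y) (hy : ∀ t, G.Adj y t ↔ t = q ∨ t = x) :
    ∃ c : Sym2 V → ℕ, (∀ e, c e < 2) ∧ IsProperPathColoring G c := by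
  classical
  have hxp : G.Adj x p := (hx p).2 (.inl rfl)
  have hxy : G.Adj x y := (hx y).2 (.inr rfl)
  have hyq : G.Adj y q := (hy q).2 (.inl rfl)
  have hyp : y ≠ p := by
    rintro rfl
    obtain ⟨t, ht, hxt⟩ := hdeg x y
    exact ((hx t).1 hxt).elim ht ht
  have hxq : x ≠ q := by
    rintro rfl
    obtain ⟨t, ht, hyt⟩ := hdeg y x
    exact ((hy t).1 hyt).elim ht ht
  let Z : V → Prop := fun z => z ≠ x ∧ z ≠ y ∧ z ≠ p ∧ z ≠ q
  have hZp : ∀ z, Z z → G.Adj p z := by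
    rintro z ⟨h1, h2, h3, h4⟩
    rcases hdist x z with h | h | ⟨t, h, h'⟩
    · exact absurd h.symm h1
    · exact ((hx z).1 h).elim (absurd · h3) (absurd · h2)
    · rcases (hx t).1 h with rfl | rfl
      · exact h'
      · exact ((hy z).1 h').elim (absurd · h4) (absurd · h1)
  have hZq : ∀ z, Z z → G.Adj q z := by
    rintro z ⟨h1, h2, h3, h4⟩
    rcases hdist y z with h | h | ⟨t, h, h'⟩
    · exact absurd h.symm h2
    · exact ((hy z).1 h).elim (absurd · h4) (absurd · h1)
    · rcases (hy t).1 h with rfl | rfl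
      · exact h'
      · exact ((hx z).1 h').elim (absurd · h3) (absurd · h2)
  by_cases hZ : ∃ z, Z z
  · obtain ⟨z₀, hz₀⟩ := hZ
    obtain ⟨B, hB⟩ : ∃ B : V → Prop, ¬ B z₀ ∧ ((∀ z, Z z → z = z₀) ∨ ∃ z, Z z ∧ B z) := by
      by_cases h : ∀ z, Z z → z = z₀
      · exact ⟨fun _ => False, not_false, .inl h⟩
      · push Not at h
        obtain ⟨z, hz, hne⟩ := h
        exact ⟨fun t => t = z, hne.symm, .inr ⟨z, hz, rfl⟩⟩
    let R : V → V → Prop := fun u v => (u = x ∧ v = p) ∨ (u = q ∧ v = y) ∨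
      (Z v ∧ ¬ B v ∧ u = p) ∨ (Z u ∧ ¬ B u ∧ v = q) ∨ (Z v ∧ B v ∧ u = q) ∨ (Z u ∧ B u ∧ v = p)
    have rxp : R x p := .inl ⟨rfl, rfl⟩
    have rqy : R q y := .inr (.inl ⟨rfl, rfl⟩)
    have rpz : ∀ z, Z z → ¬ B z → R p z := fun z h h' => .inr (.inr (.inl ⟨h, h', rfl⟩))
    have rzq : ∀ z, Z z → ¬ B z → R z q := fun z h h' => .inr (.inr (.inr (.inl ⟨h, h', rfl⟩)))
    have rqz : ∀ z, Z z → B z → R q z := fun z h h' =>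
      .inr (.inr (.inr (.inr (.inl ⟨h, h', rfl⟩))))
    have rzp : ∀ z, Z z → B z → R z p := fun z h h' =>
      .inr (.inr (.inr (.inr (.inr ⟨h, h', rfl⟩))))
    have rpq : ReflTransGen R p q := .tail (.single (rpz z₀ hz₀ hB.1)) (rzq z₀ hz₀ hB.1)
    have fromp : ∀ v, v ≠ x → ReflTransGen R p v := by
      intro v hvx
      by_cases hv : Z v
      · by_cases hb : B v
        · exact rpq.tail (rqz v hv hb)
        · exact .single (rpz v hv hb)
      · by_cases h1 : v = p
        · exact h1 ▸ .refl
        by_cases h2 : v = q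
        · exact h2 ▸ rpq
        by_cases h3 : v = y
        · exact h3 ▸ rpq.tail rqy
        exact absurd ⟨hvx, h3, h1, h2⟩ hv
    have toq : ∀ v, v ≠ y → ReflTransGen R v q := by
      intro v hvy
      by_cases hv : Z v
      · by_cases hb : B v
        · exact .head (rzp v hv hb) rpq
        · exact .single (rzq v hv hb)
      · by_cases h1 : v = p
        · exact h1 ▸ rpq
        by_cases h2 : v = q
        · exact h2 ▸ .refl
        by_cases h3 : v = x
        · exact h3 ▸ .head rxp rpq
        exact absurd ⟨h3, hvy, h1, h2⟩ hv
    have fromx : ∀ v, ReflTransGen R x v := fun v => by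
      by_cases h : v = x
      · exact h ▸ .refl
      · exact .head rxp (fromp v h)
    have toy : ∀ v, ReflTransGen R v y := fun v => by
      by_cases h : v = y
      · exact h ▸ .refl
      · exact .tail (toq v h) rqy
    refine ⟨fun e => if e = s(q, y) ∨ (∃ z, Z z ∧ ¬ B z ∧ e = s(p, z)) ∨
      ∃ z, Z z ∧ B z ∧ e = s(q, z) then 1 else 0, fun e => ?_,
      isProperPathColoring_of_unilateral (R := R) (f := fun t => if t = p ∨ t = q then 1 else 0)
        ?_ ?_ fun u v => ?_⟩
    · dsimp only
      split_ifs <;> norm_num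
    · rintro u v (⟨rfl, rfl⟩ | ⟨rfl, rfl⟩ | ⟨h, -, rfl⟩ | ⟨h, -, rfl⟩ | ⟨h, -, rfl⟩ | ⟨h, -, rfl⟩)
      exacts [hxp, hyq.symm, hZp _ h, (hZq _ h).symm, hZq _ h, (hZp _ h).symm]
    · have := hxp.ne
      have := hxy.ne
      have := hyq.ne
      intro u v huv
      simp only [R, Z, Sym2.eq_iff] at huv ⊢
      grind
    · by_cases hux : u = x
      · exact .inl (hux ▸ fromx v)
      by_cases hvx : v = x
      · exact .inr (hvx ▸ fromx u)
      by_cases huy : u = y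
      · exact .inr (huy ▸ toy v)
      by_cases hvy : v = y
      · exact .inl (hvy ▸ toy u)
      rcases hB.2 with h | ⟨z, hz, hb⟩
      · by_cases hup : u = p
        · exact .inl (hup ▸ fromp v hvx)
        by_cases hvp : v = p
        · exact .inr (hvp ▸ fromp u hux)
        by_cases huq : u = q
        · exact .inr (huq ▸ toq v hvy)
        by_cases hvq : v = q
        · exact .inl (hvq ▸ toq u huy)
        have h1 := h u ⟨hux, huy, hup, huq⟩
        have h2 := h v ⟨hvx, hvy, hvp, hvq⟩
        exact .inl (h1.trans h2.symm ▸ .refl)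
      · have rqp : ReflTransGen R q p := .tail (.single (rqz z hz hb)) (rzp z hz hb)
        exact .inl (((toq u huy).trans rqp).trans (fromp v hvx))
  · have hall : ∀ z, z = x ∨ z = y ∨ z = p ∨ z = q := fun z => by
      by_contra h
      exact hZ ⟨z, by tauto⟩
    have hpq' : G.Adj p q := by
      obtain ⟨t, ht, hpt⟩ := hdeg p x
      rcases hall t with rfl | rfl | rfl | rfl
      · exact absurd rfl ht
      · exact ((hy p).1 hpt.symm).elim (absurd · hpq) (absurd · hxp.ne.symm)
      · exact absurd hpt G.irrefl
      · exact hpt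
    let R : V → V → Prop := fun u v => (u = x ∧ v = p) ∨ (u = p ∧ v = q) ∨ (u = q ∧ v = y)
    have r1 : ReflTransGen R x p := .single (.inl ⟨rfl, rfl⟩)
    have r2 : ReflTransGen R p q := .single (.inr (.inl ⟨rfl, rfl⟩))
    have r3 : ReflTransGen R q y := .single (.inr (.inr ⟨rfl, rfl⟩))
    have r4 := r1.trans r2
    have r5 := r2.trans r3
    have r6 := r1.trans r5
    refine ⟨fun e => if e = s(p, q) then 1 else 0, fun e => ?_,
      isProperPathColoring_of_unilateral (R := R) (f := fun t => if t = p ∨ t = y then 1 else 0)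
        ?_ ?_ fun u v => ?_⟩
    · dsimp only
      split_ifs <;> norm_num
    · rintro u v (⟨rfl, rfl⟩ | ⟨rfl, rfl⟩ | ⟨rfl, rfl⟩)
      exacts [hxp, hpq', hyq.symm]
    · have := hxp.ne
      have := hxy.ne
      have := hyq.ne
      intro u v huv
      simp only [R, Sym2.eq_iff] at huv ⊢
      grind
    · rcases hall u with rfl | rfl | rfl | rfl <;> rcases hall v with rfl | rfl | rfl | rfl <;>
        first
        | exact .inl .refl
        | exact .inl (by assumption)
        | exact .inr (by assumption)

/-- Pairwise intersecting two-element neighborhoods form a star or a triangle. -/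
theorem exists_common_neighbor_or_triangle [Nonempty V]
    (hdeg : ∀ v w, ∃ y, y ≠ w ∧ G.Adj v y)
    (hdist : ∀ x y, x = y ∨ G.Adj x y ∨ ∃ z, G.Adj x z ∧ G.Adj z y)
    (hind : ∀ d d', HasAtMostTwoNeighbors G d → HasAtMostTwoNeighbors G d' → ¬ G.Adj d d') :
    (∃ a, ∀ d, HasAtMostTwoNeighbors G d → G.Adj a d) ∨
    ∃ a b c u v w, a ≠ b ∧ b ≠ c ∧ a ≠ c ∧ u ≠ c ∧ v ≠ a ∧ w ≠ b ∧
      (∀ x, G.Adj u x ↔ x = a ∨ x = b) ∧ (∀ x, G.Adj v x ↔ x = b ∨ x = c) ∧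
      (∀ x, G.Adj w x ↔ x = c ∨ x = a) := by
  rw [or_iff_not_imp_left]
  intro hstar
  push Not at hstar
  have hshare : ∀ d d', HasAtMostTwoNeighbors G d → HasAtMostTwoNeighbors G d' →
      ∃ z, G.Adj d z ∧ G.Adj z d' := by
    intro d d' h h'
    rcases hdist d d' with rfl | h'' | h''
    · obtain ⟨z, -, hz⟩ := hdeg d d
      exact ⟨z, hz, hz.symm⟩
    · exact absurd h'' (hind d d' h h')
    · exact h''
  obtain ⟨u, hu, -⟩ := hstar (Classical.arbitrary V)
  obtain ⟨a, -, hua⟩ := hdeg u u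
  obtain ⟨b, hba, hub⟩ := exists_adj_iff_eq_or_eq hdeg hu hua
  obtain ⟨v, hv, hav⟩ := hstar a
  obtain ⟨w, hw, hbw⟩ := hstar b
  have hbv : G.Adj v b := by
    obtain ⟨z, h1, h2⟩ := hshare u v hu hv
    rcases (hub z).1 h1 with rfl | rfl
    · exact absurd h2 hav
    · exact h2.symm
  have haw : G.Adj w a := by
    obtain ⟨z, h1, h2⟩ := hshare u w hu hw
    rcases (hub z).1 h1 with rfl | rfl
    · exact h2.symm
    · exact absurd h2 hbw
  obtain ⟨c, hcb, hvc⟩ := exists_adj_iff_eq_or_eq hdeg hv hbv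
  have hca : c ≠ a := by
    rintro rfl
    exact hav ((hvc c).2 (.inr rfl)).symm
  have hcw : G.Adj w c := by
    obtain ⟨z, h1, h2⟩ := hshare v w hv hw
    rcases (hvc z).1 h1 with rfl | rfl
    · exact absurd h2 hbw
    · exact h2.symm
  obtain ⟨a', ha'c, hwc⟩ := exists_adj_iff_eq_or_eq hdeg hw hcw
  obtain rfl : a = a' := ((hwc a).1 haw).resolve_left hca.symm
  have hvc' : G.Adj v c := (hvc c).2 (.inr rfl)
  refine ⟨a, b, c, u, v, w, hba.symm, hcb.symm, hca.symm, ?_, ?_, ?_, hub, hvc, hwc⟩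
  · rintro rfl
    exact hind v u hv hu hvc'
  · rintro rfl
    exact hind u v hu hv hua
  · rintro rfl
    exact hind v w hv hw hbv

end

theorem exists_adj_ne_of_induce_compl_connected {V : Type*} [Fintype V] {G : SimpleGraph V}
    (hcard : 2 < Fintype.card V) (h : ∀ v : V, (G.induce ({v} : Set V)ᶜ).Connected) (v w : V) :
    ∃ y, y ≠ w ∧ G.Adj v y := by
  classical
  have key : ∀ w, v ≠ w → ∃ y, y ≠ w ∧ G.Adj v y := by
    intro w hvw
    obtain ⟨t, ht⟩ := Finset.exists_mem_notMem_of_card_lt_card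
      (s := {v, w}) (t := Finset.univ) ((Finset.card_le_two).trans_lt hcard)
    simp only [Finset.mem_univ, Finset.mem_insert, Finset.mem_singleton, true_and, not_or] at ht
    have : Nontrivial (({w} : Set V)ᶜ : Set V) :=
      ⟨⟨v, hvw⟩, ⟨t, ht.2⟩, fun h => ht.1 (Subtype.ext_iff.1 h).symm⟩
    obtain ⟨y, hy⟩ := (h w).preconnected.exists_adj_of_nontrivial ⟨v, hvw⟩
    exact ⟨y, y.2, hy⟩
  by_cases hvw : v = w
  · subst hvw
    have : Nontrivial V := Fintype.one_lt_card_iff_nontrivial.1 (by omega)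
    obtain ⟨t, ht⟩ := exists_ne v
    obtain ⟨y, -, hy⟩ := key t ht.symm
    exact ⟨y, hy.ne.symm, hy⟩
  · exact key w hvw

theorem exists_two_coloring {V : Type*} [Fintype V] (G : SimpleGraph V)
    (hcard : 2 < Fintype.card V)
    (h2conn : ∀ v : V, (G.induce ({v} : Set V)ᶜ).Connected)
    (hconn : G.Connected)
    (hdiam_le : ∀ u v : V, G.dist u v ≤ 2)
    (hdiam_eq : ∃ u v : V, G.dist u v = 2) :
    ∃ c : Sym2 V → ℕ, (∀ e, c e < 2) ∧ IsProperPathColoring G c := by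
  have hdeg := exists_adj_ne_of_induce_compl_connected hcard h2conn
  have hdist : ∀ x y, x = y ∨ G.Adj x y ∨ ∃ z, G.Adj x z ∧ G.Adj z y := by
    intro x y
    obtain ⟨p, hp⟩ := hconn.exists_walk_length_eq_dist x y
    have := hp ▸ hdiam_le x y
    match p with
    | .nil => exact .inl rfl
    | .cons h .nil => exact .inr (.inl h)
    | .cons h (.cons h' .nil) => exact .inr (.inr ⟨_, h, h'⟩)
    | .cons h (.cons h' (.cons h'' p)) => simp at this
  have := hconn.nonempty
  by_cases hind : ∀ d d', HasAtMostTwoNeighbors G d → HasAtMostTwoNeighbors G d' → ¬ G.Adj d d'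
  · rcases exists_common_neighbor_or_triangle hdeg hdist hind with
      ⟨a, ha⟩ | ⟨a, b, c, u, v, w, h1, h2, h3, h4, h5, h6, h7, h8, h9⟩
    · exact exists_coloring_of_common_neighbor hdeg hconn hdist hind ha
    · exact exists_coloring_of_triangle hdist h1 h2 h3 h4 h5 h6 h7 h8 h9
  · push Not at hind
    obtain ⟨x, y, hx, hy, hxy⟩ := hind
    obtain ⟨p, hpy, hxp⟩ := exists_adj_iff_eq_or_eq hdeg hx hxy
    obtain ⟨q, hqx, hyq⟩ := exists_adj_iff_eq_or_eq hdeg hy hxy.symm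
    replace hxp : ∀ t, G.Adj x t ↔ t = p ∨ t = y := fun t => (hxp t).trans or_comm
    replace hyq : ∀ t, G.Adj y t ↔ t = q ∨ t = x := fun t => (hyq t).trans or_comm
    refine exists_coloring_of_adj hdeg hdist ?_ hxp hyq
    rintro rfl
    have hpx : G.Adj x p := (hxp p).2 (.inl rfl)
    have hpy' : G.Adj y p := (hyq p).2 (.inl rfl)
    have hclosed : ∀ z, z ≠ p → z = x ∨ z = y := by
      intro z hz
      obtain ⟨w⟩ := (h2conn p).preconnected ⟨x, hpx.ne⟩ ⟨z, hz⟩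
      by_contra hcon
      obtain ⟨d, -, h1, h2⟩ := w.exists_boundary_dart {t | t.1 = x ∨ t.1 = y} (.inl rfl) hcon
      have hadj : G.Adj d.fst.1 d.snd.1 := d.adj
      have hne : d.snd.1 ≠ p := d.snd.2
      rcases h1 with h1 | h1 <;> rw [h1] at hadj
      · exact h2 (((hxp _).1 hadj).elim (absurd · hne) .inr)
      · exact h2 (((hyq _).1 hadj).elim (absurd · hne) .inl)
    obtain ⟨u, v, huv⟩ := hdiam_eq
    have hu : u = p ∨ u = x ∨ u = y := or_iff_not_imp_left.2 (hclosed u)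
    have hv : v = p ∨ v = x ∨ v = y := or_iff_not_imp_left.2 (hclosed v)
    have hadj : u = v ∨ G.Adj u v := by
      rcases hu with rfl | rfl | rfl <;> rcases hv with rfl | rfl | rfl <;>
        simp [hpx, hpx.symm, hpy', hpy'.symm, hxy, hxy.symm]
    rcases hadj with rfl | h
    · simp at huv
    · rw [SimpleGraph.dist_eq_one_iff_adj.2 h] at huv
      omega

/-- If a graph is 2-connected (more than 2 vertices and deleting any single vertex leaves a
connected graph) and has diameter exactly 2, then its proper connection number equals 2. -/
theorem pc_eq_two_of_two_connected_diameter_two {V : Type*} [Fintype V] (G : SimpleGraph V)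
    (hcard : 2 < Fintype.card V)
    (h2conn : ∀ v : V, (G.induce ({v} : Set V)ᶜ).Connected)
    (hconn : G.Connected)
    (hdiam_le : ∀ u v : V, G.dist u v ≤ 2)
    (hdiam_eq : ∃ u v : V, G.dist u v = 2) :
    properConnectionNumber G = 2 := by
  have hmem := exists_two_coloring G hcard h2conn hconn hdiam_le hdiam_eq
  refine le_antisymm (Nat.sInf_le hmem) (le_csInf ⟨2, hmem⟩ ?_)
  rintro k ⟨c, hck, hc⟩
  by_contra! hk
  obtain ⟨u, v, huv⟩ := hdiam_eq
  have hne : u ≠ v := by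
    rintro rfl
    simp at huv
  have hconst : ∀ e e', c e = c e' := fun e e' => by
    have := hck e
    have := hck e'
    omega
  obtain ⟨p, -, hp⟩ := hc u v hne
  change (p.edges.map c).IsChain (· ≠ ·) at hp
  have hlen := huv ▸ SimpleGraph.dist_le p
  match p with
  | .nil => simp at hlen
  | .cons h .nil => simp at hlen
  | .cons h (.cons h' q) =>
    simp only [SimpleGraph.Walk.edges_cons, List.map_cons, List.isChain_cons_cons] at hp
    exact hp.1 (hconst _ _)
end

section
/- Almost all graphs have proper connection number 2. Precisely: the proportion of labeled simple graphs on vertex set {1,...,n} that are connected and have proper connection number equal to 2 tends to 1 as n tends to infinity. -/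
open Classical in
/-- The proportion of labeled simple graphs on `{1,…,n}` (modeled as `Fin n`) satisfying `P`,
out of all `2 ^ (n choose 2)` labeled simple graphs. -/
noncomputable def graphProportion (n : ℕ) (P : SimpleGraph (Fin n) → Prop) : ℝ :=
  ((Finset.univ.filter P).card : ℝ) / 2 ^ n.choose 2

open Finset in
/-- Functions satisfying a binary constraint on each of a family of disjoint pairs of arguments. -/
theorem card_forall_pair_mul_le {E W α : Type*} [Fintype E] [Fintype W] [Fintype α]
    (a b : W → E) (hab : Function.Injective (Sum.elim a b)) (Q : α × α → Prop) :
    Nat.card {f : E → α // ∀ w, Q (f (a w), f (b w))} * Nat.card α ^ (2 * Nat.card W) ≤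
      Nat.card {p : α × α // Q p} ^ Nat.card W * Nat.card α ^ Nat.card E := by
  classical
  let R := {e : E // e ∉ Set.range (Sum.elim a b)}
  let F : {f : E → α // ∀ w, Q (f (a w), f (b w))} → (W → {p : α × α // Q p}) × (R → α) :=
    fun f => (fun w => ⟨(f.1 (a w), f.1 (b w)), f.2 w⟩, fun e => f.1 e.1)
  have hF : Function.Injective F := by
    rintro ⟨f, hf⟩ ⟨g, hg⟩ h
    simp only [F, Prod.mk.injEq] at h
    refine Subtype.ext (funext fun e => ?_)
    by_cases he : e ∈ Set.range (Sum.elim a b)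
    · obtain ⟨w | w, rfl⟩ := he
      · have := congrFun h.1 w
        simp only [Subtype.mk.injEq, Prod.mk.injEq] at this
        exact this.1
      · have := congrFun h.1 w
        simp only [Subtype.mk.injEq, Prod.mk.injEq] at this
        exact this.2
    · exact congrFun h.2 ⟨e, he⟩
  have hcard := Nat.card_le_card_of_injective F hF
  rw [Nat.card_prod, Nat.card_fun, Nat.card_fun] at hcard
  have hR : Nat.card E = Nat.card R + 2 * Nat.card W := by
    rw [Nat.card_congr (Equiv.sumCompl (· ∈ Set.range (Sum.elim a b))).symm, Nat.card_sum,
      Nat.card_congr (Equiv.ofInjective _ hab).symm, Nat.card_sum]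
    simp only [R]
    ring
  rw [hR, pow_add, ← mul_assoc]
  exact Nat.mul_le_mul_right _ hcard

/-- A simple graph amounts to a `Bool`-valued function on the non-loop unordered pairs. -/
noncomputable def SimpleGraph.equivNotDiagBool (V : Type*) :
    SimpleGraph V ≃ ({e : Sym2 V // ¬ e.IsDiag} → Bool) :=
  open Classical in
  { toFun G e := decide (e.1 ∈ G.edgeSet)
    invFun f := SimpleGraph.fromEdgeSet {e | ∃ h, f ⟨e, h⟩ = true}
    left_inv G := by
      ext u v
      simp only [SimpleGraph.fromEdgeSet_adj, Set.mem_ofPred_eq, decide_eq_true_eq,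
        SimpleGraph.mem_edgeSet, Sym2.mk_isDiag_iff, exists_prop]
      exact ⟨fun h => h.1.2, fun h => ⟨⟨h.ne, h⟩, h.ne⟩⟩
    right_inv f := by
      ext ⟨e, he⟩
      simp [he] }

theorem SimpleGraph.equivNotDiagBool_mk {V : Type*} (G : SimpleGraph V) {u v : V}
    (h : ¬ s(u, v).IsDiag) :
    SimpleGraph.equivNotDiagBool V G ⟨s(u, v), h⟩ = true ↔ G.Adj u v := by
  simp [SimpleGraph.equivNotDiagBool]

theorem SimpleGraph.natCard_notDiag (n : ℕ) :
    Nat.card {e : Sym2 (Fin n) // ¬ e.IsDiag} = n.choose 2 := by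
  classical
  rw [Nat.card_eq_fintype_card, Sym2.card_subtype_not_diag, Fintype.card_fin]

theorem SimpleGraph.natCard_fin (n : ℕ) : Nat.card (SimpleGraph (Fin n)) = 2 ^ n.choose 2 := by
  rw [Nat.card_congr (SimpleGraph.equivNotDiagBool (Fin n)), Nat.card_fun,
    SimpleGraph.natCard_notDiag]
  simp

/-- `u` and `v` have a common `G`-neighbor whose edges to them are distinguished by `H`. -/
def HasBicoloredCherry {V : Type*} (G H : SimpleGraph V) (u v : V) : Prop :=
  ∃ w, G.Adj u w ∧ G.Adj v w ∧ (H.Adj u w ↔ ¬ H.Adj v w)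

theorem card_not_hasBicoloredCherry_mul_le {n : ℕ} {u v : Fin n} (huv : u ≠ v) :
    Nat.card {p : SimpleGraph (Fin n) × SimpleGraph (Fin n) //
      ¬ HasBicoloredCherry p.1 p.2 u v} * 16 ^ (n - 2) ≤ 14 ^ (n - 2) * 4 ^ n.choose 2 := by
  classical
  let E := {e : Sym2 (Fin n) // ¬ e.IsDiag}
  let W := {w : Fin n // w ∉ ({u, v} : Finset (Fin n))}
  have hW (w : W) : u ≠ w.1 ∧ v ≠ w.1 := by
    have := w.2
    simp only [Finset.mem_insert, Finset.mem_singleton, not_or] at this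
    exact ⟨Ne.symm this.1, Ne.symm this.2⟩
  have hWcard : Nat.card W = n - 2 := by
    rw [Nat.card_eq_fintype_card, Fintype.card_subtype_compl, Fintype.card_coe, Fintype.card_fin,
      Finset.card_pair huv]
  let a : W → E := fun w => ⟨s(u, w.1), by simpa using (hW w).1⟩
  let b : W → E := fun w => ⟨s(v, w.1), by simpa using (hW w).2⟩
  have hab : Function.Injective (Sum.elim a b) := by
    rintro (w | w) (x | x) h <;>
      have h1 := hW w <;> have h2 := hW x <;>
      simp only [Sum.elim_inl, Sum.elim_inr, a, b, E, Subtype.mk.injEq, Sym2.eq_iff] at h <;>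
      grind
  let Q : (Bool × Bool) × (Bool × Bool) → Prop :=
    fun p => ¬ (p.1.1 = true ∧ p.2.1 = true ∧ (p.1.2 = true ↔ ¬ p.2.2 = true))
  have hQ : Nat.card {p // Q p} = 14 := by
    rw [Nat.card_eq_fintype_card, Fintype.card_subtype]
    simp only [Q]
    decide
  have key := card_forall_pair_mul_le a b hab Q
  rw [hQ, hWcard, SimpleGraph.natCard_notDiag, pow_mul] at key
  simp only [Nat.card_eq_fintype_card, Fintype.card_prod, Fintype.card_bool] at key
  norm_num at key
  refine le_trans (Nat.mul_le_mul_right _ ?_) key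
  rw [← Nat.card_eq_fintype_card]
  let eq := SimpleGraph.equivNotDiagBool (Fin n)
  refine Nat.card_le_card_of_injective
    (fun p => ⟨fun e => (eq p.1.1 e, eq p.1.2 e), fun w => ?_⟩) ?_
  · intro h
    refine p.2 ⟨w.1, ?_⟩
    simpa only [a, b, eq, SimpleGraph.equivNotDiagBool_mk] using h
  · rintro ⟨⟨G, H⟩, hp⟩ ⟨⟨K, L⟩, hq⟩ h
    simp only [Subtype.mk.injEq] at h
    have h1 : eq G = eq K := funext fun e => congrArg Prod.fst (congrFun h e)
    have h2 : eq H = eq L := funext fun e => congrArg Prod.snd (congrFun h e)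
    simp [eq.injective h1, eq.injective h2]

theorem isProperPathColoring_of_hasBicoloredCherry {V : Type*} {G H : SimpleGraph V}
    [DecidablePred (· ∈ H.edgeSet)] (h : ∀ u v, u ≠ v → HasBicoloredCherry G H u v) :
    IsProperPathColoring G (fun e => if e ∈ H.edgeSet then 1 else 0) := by
  intro u v huv
  obtain ⟨w, huw, hvw, hH⟩ := h u v huv
  refine ⟨.cons huw (.cons hvw.symm .nil), ?_, ?_⟩
  · simp [SimpleGraph.Walk.cons_isPath_iff, huw.ne, hvw.ne.symm, huv]
  · change List.IsChain _ _
    simp only [SimpleGraph.Walk.edges_cons, SimpleGraph.Walk.edges_nil, List.map_cons,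
      List.map_nil, List.isChain_cons_cons, SimpleGraph.mem_edgeSet]
    by_cases h1 : H.Adj v w <;> simp_all [H.adj_comm w v]

theorem IsProperPathColoring.eq_top_of_lt_one {V : Type*} {G : SimpleGraph V} {c : Sym2 V → ℕ}
    (h : IsProperPathColoring G c) (hc : ∀ e, c e < 1) : G = ⊤ := by
  ext u v
  simp only [SimpleGraph.top_adj]
  refine ⟨fun h => h.ne, fun huv => ?_⟩
  obtain ⟨p, -, hp⟩ := h u v huv
  match p with
  | .nil => exact absurd rfl huv
  | .cons h .nil => exact h
  | .cons h (.cons h' p) =>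
    have h0 (e) : c e = 0 := by have := hc e; omega
    change List.IsChain _ _ at hp
    simp [h0] at hp

theorem connected_and_properConnectionNumber_eq_two {V : Type*} [Nonempty V]
    {G H : SimpleGraph V} (hG : G ≠ ⊤) (h : ∀ u v, u ≠ v → HasBicoloredCherry G H u v) :
    G.Connected ∧ properConnectionNumber G = 2 := by
  classical
  have hc := isProperPathColoring_of_hasBicoloredCherry h
  constructor
  · refine ⟨fun u v => ?_⟩
    by_cases huv : u = v
    · exact huv ▸ .rfl
    · obtain ⟨p, -⟩ := hc u v huv
      exact ⟨p⟩
  · refine le_antisymm (Nat.sInf_le ⟨_, fun e => ?_, hc⟩) (le_csInf ⟨2, _, fun e => ?_, hc⟩ ?_)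
    · split_ifs <;> norm_num
    · split_ifs <;> norm_num
    · rintro k ⟨c, hk, hc⟩
      by_contra! hlt
      exact hG (hc.eq_top_of_lt_one fun e => (hk e).trans_le (by omega))

open Classical in
theorem card_filter_forall_exists_not_mul_le (n : ℕ) :
    ({G | ∀ H, ∃ u v, u ≠ v ∧ ¬ HasBicoloredCherry G H u v} :
      Finset (SimpleGraph (Fin n))).card * 16 ^ (n - 2) ≤
        n ^ 2 * (14 ^ (n - 2) * 2 ^ n.choose 2) := by
  set B : Finset (SimpleGraph (Fin n)) :=
    {G | ∀ H, ∃ u v, u ≠ v ∧ ¬ HasBicoloredCherry G H u v}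
  let S (x : Fin n × Fin n) : Finset (SimpleGraph (Fin n) × SimpleGraph (Fin n)) :=
    {p | x.1 ≠ x.2 ∧ ¬ HasBicoloredCherry p.1 p.2 x.1 x.2}
  have hS (x) : (S x).card * 16 ^ (n - 2) ≤ 14 ^ (n - 2) * 4 ^ n.choose 2 := by
    by_cases hx : x.1 = x.2
    · simp [S, hx]
    · have := card_not_hasBicoloredCherry_mul_le hx
      rw [Nat.card_eq_fintype_card, Fintype.card_subtype] at this
      simpa [S, hx] using this
  have hsub : B ×ˢ Finset.univ ⊆ Finset.univ.biUnion S := by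
    rintro ⟨G, H⟩ hp
    simp only [B, Finset.mem_product, Finset.mem_filter, Finset.mem_univ, true_and,
      and_true] at hp
    obtain ⟨u, v, h⟩ := hp H
    simp only [S, Finset.mem_biUnion, Finset.mem_filter, Finset.mem_univ, true_and]
    exact ⟨(u, v), h⟩
  have hle := (Finset.card_le_card hsub).trans Finset.card_biUnion_le
  rw [Finset.card_product, Finset.card_univ, ← Nat.card_eq_fintype_card,
    SimpleGraph.natCard_fin] at hle
  refine Nat.le_of_mul_le_mul_right (c := 2 ^ n.choose 2) ?_ (by positivity)
  calc B.card * 16 ^ (n - 2) * 2 ^ n.choose 2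
      = B.card * 2 ^ n.choose 2 * 16 ^ (n - 2) := by ring
    _ ≤ (∑ x, (S x).card) * 16 ^ (n - 2) := Nat.mul_le_mul_right _ hle
    _ = ∑ x, (S x).card * 16 ^ (n - 2) := Finset.sum_mul ..
    _ ≤ ∑ _x : Fin n × Fin n, 14 ^ (n - 2) * 4 ^ n.choose 2 :=
        Finset.sum_le_sum fun x _ => hS x
    _ = n ^ 2 * (14 ^ (n - 2) * 2 ^ n.choose 2) * 2 ^ n.choose 2 := by
        rw [show 4 = 2 * 2 from rfl, mul_pow]
        simp
        ring

theorem graphProportion_le_one {n : ℕ} (P : SimpleGraph (Fin n) → Prop) :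
    graphProportion n P ≤ 1 := by
  classical
  rw [graphProportion, div_le_one (by positivity)]
  have : (Finset.univ.filter P).card ≤ 2 ^ n.choose 2 := by
    rw [← SimpleGraph.natCard_fin, Nat.card_eq_fintype_card]
    exact Finset.card_le_univ _
  convert (Nat.cast_le (α := ℝ)).2 this
  simp

theorem one_sub_le_graphProportion {n : ℕ} (hn : 2 ≤ n) :
    1 - ((n : ℝ) ^ 2 * (7 / 8) ^ (n - 2) + (1 / 2) ^ n.choose 2) ≤
      graphProportion n (fun G => G.Connected ∧ properConnectionNumber G = 2) := by
  classical
  have : Nonempty (Fin n) := ⟨⟨0, by omega⟩⟩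
  set A : Finset (SimpleGraph (Fin n)) :=
    {G | G.Connected ∧ properConnectionNumber G = 2} with hA
  set B : Finset (SimpleGraph (Fin n)) :=
    {G | ∀ H, ∃ u v, u ≠ v ∧ ¬ HasBicoloredCherry G H u v} with hB
  have hcover : (Finset.univ : Finset (SimpleGraph (Fin n))) ⊆ A ∪ (B ∪ {⊤}) := by
    intro G _
    by_cases hG : G = ⊤
    · simp [hG]
    by_cases h : ∀ H, ∃ u v, u ≠ v ∧ ¬ HasBicoloredCherry G H u v
    · simp [hB, h]
    · push Not at h
      obtain ⟨H, hH⟩ := h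
      exact Finset.mem_union_left _ (by
        simpa [hA] using connected_and_properConnectionNumber_eq_two hG hH)
  have hcard : 2 ^ n.choose 2 ≤ A.card + (B.card + 1) := by
    rw [← SimpleGraph.natCard_fin, Nat.card_eq_fintype_card, ← Finset.card_univ]
    refine (Finset.card_le_card hcover).trans ((Finset.card_union_le _ _).trans ?_)
    exact Nat.add_le_add_left (Finset.card_union_le _ _) _
  have hBle : (B.card : ℝ) * 16 ^ (n - 2) ≤ n ^ 2 * (14 ^ (n - 2) * 2 ^ n.choose 2) := by
    exact_mod_cast card_filter_forall_exists_not_mul_le n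
  have hBle' : (B.card : ℝ) ≤ n ^ 2 * (7 / 8) ^ (n - 2) * 2 ^ n.choose 2 := by
    rw [show (7 / 8 : ℝ) = 14 / 16 by norm_num, div_pow]
    rw [← le_div_iff₀ (by positivity)] at hBle
    refine hBle.trans (le_of_eq ?_)
    ring
  have hcard' : (2 : ℝ) ^ n.choose 2 ≤ A.card + (B.card + 1) := by exact_mod_cast hcard
  have hprop : graphProportion n (fun G => G.Connected ∧ properConnectionNumber G = 2) =
      (A.card : ℝ) / 2 ^ n.choose 2 := by
    rw [graphProportion, hA]
    congr!
  rw [hprop, le_div_iff₀ (by positivity)]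
  have hone : (1 / 2 : ℝ) ^ n.choose 2 * 2 ^ n.choose 2 = 1 := by
    rw [← mul_pow]; norm_num
  linarith

/-- Almost all graphs are connected with proper connection number 2. -/
theorem almost_all_graphs_pc_eq_two :
    Filter.Tendsto
      (fun n => graphProportion n (fun G => G.Connected ∧ properConnectionNumber G = 2))
      Filter.atTop (nhds 1) := by
  have h1 : Filter.Tendsto (fun n : ℕ => (n : ℝ) ^ 2 * (7 / 8) ^ (n - 2))
      Filter.atTop (nhds 0) := by
    have h := (tendsto_pow_const_mul_const_pow_of_lt_one 2 (r := (7 / 8 : ℝ))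
      (by norm_num) (by norm_num)).mul_const ((64 : ℝ) / 49)
    rw [zero_mul] at h
    refine h.congr' ?_
    filter_upwards [Filter.eventually_ge_atTop 2] with n hn
    obtain ⟨m, rfl⟩ := Nat.exists_eq_add_of_le' hn
    rw [Nat.add_sub_cancel, pow_add]
    ring
  have h2 : Filter.Tendsto (fun n : ℕ => (1 / 2 : ℝ) ^ n.choose 2) Filter.atTop (nhds 0) := by
    refine (tendsto_pow_atTop_nhds_zero_of_lt_one (by norm_num) (by norm_num)).comp ?_
    refine Filter.tendsto_atTop_mono' _ ?_ (Filter.tendsto_sub_atTop_nat 1)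
    filter_upwards [Filter.eventually_ge_atTop 2] with n hn
    obtain ⟨m, rfl⟩ := Nat.exists_eq_add_of_le' hn
    rw [Nat.choose_succ_succ' (m + 1) 1, Nat.choose_one_right]
    omega
  have h3 := (h1.add h2).const_sub 1
  rw [add_zero, sub_zero] at h3
  refine tendsto_of_tendsto_of_tendsto_of_le_of_le' h3 tendsto_const_nhds ?_
    (.of_forall fun n => graphProportion_le_one _)
  filter_upwards [Filter.eventually_ge_atTop 2] with n hn
  exact one_sub_le_graphProportion hn
end

section
/- For each fixed integer r ≥ 3, almost all r-regular graphs have proper connection number 2. Precisely: for fixed r ≥ 3, the number of labeled r-regular simple graphs on vertex set {1,...,n} that have proper connection number equal to 2, divided by the total number of labeled r-regular simple graphs on vertex set {1,...,n}, tends to 1 as n tends to infinity along those n with rn even and n ≥ r+1. -/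
open Classical in
/-- The proportion, among labeled `r`-regular simple graphs on `Fin n`, of those satisfying `P`. -/
noncomputable def regularProportion (r n : ℕ) (P : SimpleGraph (Fin n) → Prop) : ℝ :=
  ((Finset.univ.filter
      (fun G : SimpleGraph (Fin n) => (∀ v, (G.neighborSet v).ncard = r) ∧ P G)).card : ℝ) /
    ((Finset.univ.filter
      (fun G : SimpleGraph (Fin n) => ∀ v, (G.neighborSet v).ncard = r)).card : ℝ)

open Finset

/-- Robbins' theorem: a graph in which every cut contains at least two edges has a strongly
connected orientation. -/
theorem SimpleGraph.exists_strong_orientation {V : Type*} [Finite V] (H : SimpleGraph V)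
    (hH : ∀ X : Set V, ∀ u ∈ X, ∀ v ∉ X, ∃ a ∈ X, ∃ b ∉ X, H.Adj a b ∧ (a, b) ≠ (u, v)) :
    ∃ D : V → V → Prop, (∀ a b, D a b → H.Adj a b) ∧ (∀ a b, D a b → ¬ D b a) ∧
      ∀ u v, Relation.ReflTransGen D u v := by
  classical
  let P : Set (V × V) → Prop := fun D => (∀ p ∈ D, H.Adj p.1 p.2) ∧
    (∀ a b, H.Adj a b → (a, b) ∈ D ∨ (b, a) ∈ D) ∧
    ∀ X : Set V, ∀ u ∈ X, ∀ v ∉ X, ∃ a ∈ X, ∃ b ∉ X, (a, b) ∈ D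
  obtain ⟨D, ⟨hD₁, hD₂, hD₃⟩, hmin⟩ := exists_minimal_of_wellFoundedLT P
    ⟨{p | H.Adj p.1 p.2}, fun p hp => hp, fun a b h => Or.inl h, fun X u hu v hv => by
      obtain ⟨a, ha, b, hb, h, -⟩ := hH X u hu v hv
      exact ⟨a, ha, b, hb, h⟩⟩
  have removal : ∀ a b, (a, b) ∈ D → (b, a) ∈ D →
      ∃ X : Set V, a ∈ X ∧ b ∉ X ∧ ∀ x ∈ X, ∀ y ∉ X, (x, y) ∈ D → (x, y) = (a, b) := by
    intro a b hab hba
    by_contra! hcon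
    have hne : a ≠ b := (hD₁ _ hab).ne
    have hP : P (D \ {(a, b)}) := by
      refine ⟨fun p hp => hD₁ p hp.1, fun x y hxy => ?_, fun X u hu v hv => ?_⟩
      · rcases hD₂ x y hxy with h | h
        · by_cases he : (x, y) = (a, b)
          · obtain ⟨rfl, rfl⟩ := Prod.mk.inj he
            exact Or.inr ⟨hba, fun h' => hne (Prod.mk.inj h').2⟩
          · exact Or.inl ⟨h, he⟩
        · by_cases he : (y, x) = (a, b)
          · obtain ⟨rfl, rfl⟩ := Prod.mk.inj he
            exact Or.inl ⟨hba, fun h' => hne (Prod.mk.inj h').2⟩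
          · exact Or.inr ⟨h, he⟩
      · obtain ⟨x, hx, y, hy, hxy⟩ := hD₃ X u hu v hv
        by_cases he : (x, y) = (a, b)
        · obtain ⟨rfl, rfl⟩ := Prod.mk.inj he
          obtain ⟨x', hx', y', hy', h, hne'⟩ := hcon X hx hy
          exact ⟨x', hx', y', hy', h, hne'⟩
        · exact ⟨x, hx, y, hy, hxy, he⟩
    exact (hmin hP Set.sdiff_subset hab).2 rfl
  refine ⟨fun a b => (a, b) ∈ D, fun a b h => hD₁ _ h, fun a b hab hba => ?_, fun u v => ?_⟩
  · obtain ⟨X, haX, hbX, hX⟩ := removal a b hab hba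
    obtain ⟨Y, hbY, haY, hY⟩ := removal b a hba hab
    have hinter : ∀ z, z ∈ X → z ∉ Y := by
      intro z hzX hzY
      obtain ⟨x, hx, y, hy, hxy⟩ := hD₃ (X ∩ Y) z ⟨hzX, hzY⟩ a (fun h => haY h.2)
      by_cases hyX : y ∈ X
      · obtain ⟨rfl, rfl⟩ := Prod.mk.inj (hY x hx.2 y (fun h => hy ⟨hyX, h⟩) hxy)
        exact hbX hx.1
      · obtain ⟨rfl, rfl⟩ := Prod.mk.inj (hX x hx.1 y hyX hxy)
        exact haY hx.2
    have hunion : ∀ z, z ∉ X → z ∈ Y := by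
      intro z hzX
      by_contra hzY
      obtain ⟨x, hx, y, hy, hxy⟩ := hD₃ (X ∪ Y) a (Or.inl haX) z (fun h => h.elim hzX hzY)
      rcases hx with hx | hx
      · obtain ⟨rfl, rfl⟩ := Prod.mk.inj (hX x hx y (fun h => hy (Or.inl h)) hxy)
        exact hy (Or.inr hbY)
      · obtain ⟨rfl, rfl⟩ := Prod.mk.inj (hY x hx y (fun h => hy (Or.inr h)) hxy)
        exact hy (Or.inl haX)
    obtain ⟨x, hx, y, hy, hxy, hne⟩ := hH X a haX b hbX
    rcases hD₂ x y hxy with h | h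
    · exact hne (hX x hx y hy h)
    · obtain ⟨rfl, rfl⟩ := Prod.mk.inj (hY y (hunion y hy) x (hinter x hx) h)
      exact hne rfl
  · by_contra hcon
    obtain ⟨x, hx, y, hy, hxy⟩ :=
      hD₃ {w | Relation.ReflTransGen (fun a b => (a, b) ∈ D) u w} u .refl v hcon
    exact hy (Relation.ReflTransGen.tail hx hxy)

open Classical in
/-- The ordered pairs `(x, y)` of adjacent vertices with `x ∈ S` and `y ∉ S`. -/
noncomputable def SimpleGraph.cutPairs {V : Type*} [Fintype V] (G : SimpleGraph V)
    (S : Finset V) : Finset (V × V) :=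
  univ.filter fun p => p.1 ∈ S ∧ p.2 ∉ S ∧ G.Adj p.1 p.2

theorem SimpleGraph.mem_cutPairs {V : Type*} [Fintype V] {G : SimpleGraph V} {S : Finset V}
    {p : V × V} : p ∈ G.cutPairs S ↔ p.1 ∈ S ∧ p.2 ∉ S ∧ G.Adj p.1 p.2 := by
  simp [cutPairs]

/-- The spanning bipartite subgraph formed by a maximum cut contains at least half of the edges of
every cut. -/
theorem SimpleGraph.exists_bipartition_half_cut {V : Type*} [Fintype V] (G : SimpleGraph V) :
    ∃ f : V → Bool, ∀ S : Finset V,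
      (G.cutPairs S).card ≤ 2 * ((G.cutPairs S).filter fun p => f p.1 ≠ f p.2).card := by
  classical
  let T : (V → Bool) → Finset (V × V) := fun f =>
    univ.filter fun p => G.Adj p.1 p.2 ∧ f p.1 ≠ f p.2
  obtain ⟨f, hf⟩ := Finite.exists_max fun f => (T f).card
  refine ⟨f, fun S => ?_⟩
  let f' : V → Bool := fun x => if x ∈ S then !f x else f x
  let I : (V → Bool) → Finset (V × V) := fun g => (T g).filter fun p => p.1 ∈ S ↔ p.2 ∈ S
  let O : (V → Bool) → Finset (V × V) := fun g => (G.cutPairs S).filter fun p => g p.1 ≠ g p.2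
  have split : ∀ g, (T g).card = (I g).card + 2 * (O g).card := by
    intro g
    have h₁ : (T g).card = (I g).card +
        ((T g).filter fun p => ¬ (p.1 ∈ S ↔ p.2 ∈ S)).card :=
      (Finset.card_filter_add_card_filter_not _).symm
    have h₂ : ((T g).filter fun p => ¬ (p.1 ∈ S ↔ p.2 ∈ S)) =
        O g ∪ (O g).map (Equiv.prodComm V V).toEmbedding := by
      ext ⟨x, y⟩
      simp only [T, O, mem_filter, mem_univ, true_and, mem_union, mem_map, mem_cutPairs,
        Equiv.coe_toEmbedding, Equiv.prodComm_apply, Prod.exists, Prod.swap_prod_mk,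
        Prod.mk.injEq]
      constructor
      · rintro ⟨⟨h, hg⟩, hS⟩
        by_cases hx : x ∈ S
        · exact Or.inl ⟨⟨hx, by tauto, h⟩, hg⟩
        · exact Or.inr ⟨y, x, ⟨⟨by tauto, hx, h.symm⟩, hg.symm⟩, rfl, rfl⟩
      · rintro (⟨⟨hx, hy, h⟩, hg⟩ | ⟨a, b, ⟨⟨hx, hy, h⟩, hg⟩, rfl, rfl⟩)
        · exact ⟨⟨h, hg⟩, by tauto⟩
        · exact ⟨⟨h.symm, hg.symm⟩, by tauto⟩
    have h₃ : Disjoint (O g) ((O g).map (Equiv.prodComm V V).toEmbedding) := by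
      rw [Finset.disjoint_left]
      rintro ⟨x, y⟩ hxy hyx
      simp only [O, mem_filter, mem_map, mem_cutPairs, Equiv.coe_toEmbedding,
        Equiv.prodComm_apply, Prod.exists, Prod.swap_prod_mk, Prod.mk.injEq] at hxy hyx
      obtain ⟨a, b, ⟨⟨ha, -⟩, -⟩, rfl, rfl⟩ := hyx
      exact hxy.1.2.1 ha
    rw [h₁, h₂, card_union_of_disjoint h₃, card_map]
    ring
  have hI : I f' = I f := by
    ext ⟨x, y⟩
    simp only [I, T, f', mem_filter, mem_univ, true_and]
    by_cases hx : x ∈ S <;> by_cases hy : y ∈ S <;> simp [hx, hy]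
  have hO : O f' = (G.cutPairs S).filter fun p => ¬ (f p.1 ≠ f p.2) := by
    ext ⟨x, y⟩
    simp only [O, f', mem_filter, mem_cutPairs]
    by_cases hx : x ∈ S <;> by_cases hy : y ∈ S <;> simp [hx, hy]
  have h₁ := hf f'
  have h₂ := card_filter_add_card_filter_not (s := G.cutPairs S) fun p => f p.1 ≠ f p.2
  simp only [split, hI] at h₁
  rw [hO] at h₁
  change _ + 2 * _ ≤ _ + 2 * ((G.cutPairs S).filter fun p => f p.1 ≠ f p.2).card at h₁
  omega

theorem SimpleGraph.exists_walk_of_reflTransGen {V : Type*} {G : SimpleGraph V}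
    {D : V → V → Prop} (hD : ∀ a b, D a b → G.Adj a b) {u v : V}
    (h : Relation.ReflTransGen D u v) : ∃ p : G.Walk u v, ∀ d ∈ p.darts, D d.fst d.snd := by
  induction h using Relation.ReflTransGen.head_induction_on with
  | refl => exact ⟨.nil, by simp⟩
  | head hab _ ih =>
    obtain ⟨p, hp⟩ := ih
    refine ⟨.cons (hD _ _ hab) p, fun d hd => ?_⟩
    rw [SimpleGraph.Walk.darts_cons, List.mem_cons] at hd
    rcases hd with rfl | hd
    · exact hab
    · exact hp d hd

theorem SimpleGraph.Walk.isChain_edges_map_ne {V : Type*} {G : SimpleGraph V}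
    {D : V → V → Prop} {f : V → Bool} {c : Sym2 V → ℕ} (hf : ∀ a b, D a b → f a ≠ f b)
    (hc : ∀ a b, D a b → c s(a, b) = (f a).toNat) {u v : V} (p : G.Walk u v)
    (hp : ∀ d ∈ p.darts, D d.fst d.snd) : (p.edges.map c).IsChain (· ≠ ·) := by
  induction p with
  | nil => simp
  | cons h q ih =>
    have hq := ih fun d hd => hp d (by simp [hd])
    cases q with
    | nil => simp
    | cons h' q =>
      have h₁ := hp ⟨(_, _), h⟩ (by simp)
      have h₂ := hp ⟨(_, _), h'⟩ (by simp)
      simp only [edges_cons, List.map_cons] at hq ⊢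
      refine List.IsChain.cons_cons ?_ hq
      rw [hc _ _ h₁, hc _ _ h₂]
      have := hf _ _ h₁
      simp only at this
      revert this
      cases f _ <;> cases f _ <;> simp

/-- A graph all of whose cuts have at least three edges has a proper-path coloring with two
colors. -/
theorem exists_isProperPathColoring_two {V : Type*} [Fintype V] (G : SimpleGraph V)
    (hG : ∀ S : Finset V, S.Nonempty → S ≠ univ → 3 ≤ (G.cutPairs S).card) :
    ∃ c : Sym2 V → ℕ, (∀ e, c e < 2) ∧ IsProperPathColoring G c := by
  classical
  obtain ⟨f, hf⟩ := G.exists_bipartition_half_cut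
  let H : SimpleGraph V :=
    { Adj := fun x y => G.Adj x y ∧ f x ≠ f y
      symm := ⟨fun x y h => ⟨h.1.symm, h.2.symm⟩⟩
      loopless := ⟨fun x h => h.2 rfl⟩ }
  obtain ⟨D, hDH, hDanti, hD⟩ := H.exists_strong_orientation fun X u hu v hv => by
    have h₁ := hG X.toFinset ⟨u, by simpa⟩ (fun h => hv (by
      rw [← Set.mem_toFinset, h]
      exact mem_univ v))
    have h₂ := hf X.toFinset
    obtain ⟨⟨a, b⟩, hab, hne⟩ := Finset.exists_mem_ne
      (s := (G.cutPairs X.toFinset).filter fun p => f p.1 ≠ f p.2) (by omega) (u, v)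
    simp only [mem_filter, SimpleGraph.mem_cutPairs, Set.mem_toFinset] at hab
    exact ⟨a, hab.1.1, b, hab.1.2.1, ⟨hab.1.2.2, hab.2⟩, hne⟩
  let c : Sym2 V → ℕ := fun e => if ∃ x y, e = s(x, y) ∧ D x y ∧ f x = true then 1 else 0
  refine ⟨c, fun e => by simp only [c]; split_ifs <;> norm_num, fun u v _ => ?_⟩
  obtain ⟨p, hp⟩ := SimpleGraph.exists_walk_of_reflTransGen (fun a b h => (hDH a b h).1) (hD u v)
  refine ⟨p.bypass, p.bypass_isPath, ?_⟩
  refine SimpleGraph.Walk.isChain_edges_map_ne (D := D) (f := f) (fun a b h => (hDH a b h).2)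
    (fun a b h => ?_) _ fun d hd => hp d (p.darts_bypass_subset_darts hd)
  have key : (∃ x y, s(a, b) = s(x, y) ∧ D x y ∧ f x = true) ↔ f a = true := by
    constructor
    · rintro ⟨x, y, he, hxy, hx⟩
      rcases Sym2.eq_iff.1 he with ⟨rfl, rfl⟩ | ⟨rfl, rfl⟩
      · exact hx
      · exact absurd h (hDanti _ _ hxy)
    · exact fun ha => ⟨a, b, rfl, h, ha⟩
  simp only [c, key]
  cases f a <;> simp

theorem properConnectionNumber_eq_two {V : Type*} [Fintype V] (G : SimpleGraph V)
    (hG : ∀ S : Finset V, S.Nonempty → S ≠ univ → 3 ≤ (G.cutPairs S).card)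
    {u v : V} (huv : u ≠ v) (hadj : ¬ G.Adj u v) : properConnectionNumber G = 2 := by
  have h₂ := exists_isProperPathColoring_two G hG
  refine le_antisymm (Nat.sInf_le h₂) (le_csInf ⟨2, h₂⟩ ?_)
  rintro k ⟨c, hc, hpc⟩
  by_contra! hk
  have hc0 : ∀ e, c e = 0 := fun e => by have := hc e; omega
  obtain ⟨p, -, hp⟩ := hpc u v huv
  cases p with
  | nil => exact huv rfl
  | cons h q =>
    cases q with
    | nil => exact hadj h
    | cons h' q =>
      simp only [SimpleGraph.Walk.edges_cons, List.map_cons, hc0] at hp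
      exact (List.isChain_cons_cons.1 hp).1 rfl

/-- The graph obtained from `G` by switching along the closed walk `a b d c`. -/
def SimpleGraph.switch {V : Type*} (G : SimpleGraph V) (a b c d : V) : SimpleGraph V :=
  symmDiff G (SimpleGraph.fromEdgeSet {s(a, b), s(c, d), s(a, c), s(b, d)})

namespace SimpleGraph

variable {V : Type*} {G : SimpleGraph V} {a b c d : V}

theorem switch_swap_pairs : G.switch c d a b = G.switch a b c d := by
  unfold switch
  congr 2
  ext e
  simp only [Set.mem_insert_iff, Set.mem_singleton_iff, Sym2.eq_swap (a := c) (b := a),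
    Sym2.eq_swap (a := d) (b := b)]
  tauto

theorem switch_swap_ends : G.switch b a d c = G.switch a b c d := by
  unfold switch
  congr 2
  ext e
  simp only [Set.mem_insert_iff, Set.mem_singleton_iff, Sym2.eq_swap (a := b) (b := a),
    Sym2.eq_swap (a := d) (b := c)]
  tauto

theorem switch_adj {x y : V} : (G.switch a b c d).Adj x y ↔
    Xor (G.Adj x y) ((s(x, y) = s(a, b) ∨ s(x, y) = s(c, d) ∨ s(x, y) = s(a, c) ∨
      s(x, y) = s(b, d)) ∧ x ≠ y) := by
  simp only [switch, symmDiff, sup_adj, sdiff_adj, fromEdgeSet_adj, Set.mem_insert_iff,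
    Set.mem_singleton_iff, Xor]

/-- The quadruples `(a, b, c, d)` at which switching replaces the edges `ab` (with both ends in
`S`) and `cd` (with both ends outside `S`) by the edges `ac` and `bd`. -/
structure IsSwitchable (G : SimpleGraph V) (S : Finset V) (a b c d : V) : Prop where
  a_mem : a ∈ S
  b_mem : b ∈ S
  c_notMem : c ∉ S
  d_notMem : d ∉ S
  adj_ab : G.Adj a b
  adj_cd : G.Adj c d
  not_adj_ac : ¬ G.Adj a c
  not_adj_bd : ¬ G.Adj b d

variable {S : Finset V}

theorem IsSwitchable.swap_ends (h : G.IsSwitchable S a b c d) : G.IsSwitchable S b a d c :=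
  ⟨h.b_mem, h.a_mem, h.d_notMem, h.c_notMem, h.adj_ab.symm, h.adj_cd.symm, h.not_adj_bd,
    h.not_adj_ac⟩

theorem neighborSet_switch_eq_insert (hab : G.Adj a b) (hac : a ≠ c) (had : a ≠ d) (hbc : b ≠ c)
    (h : ¬ G.Adj a c) :
    (G.switch a b c d).neighborSet a = insert c (G.neighborSet a \ {b}) := by
  ext x
  have := hab.ne
  simp only [mem_neighborSet, switch_adj, Set.mem_insert_iff, Set.mem_sdiff,
    Set.mem_singleton_iff, Sym2.eq_iff, Xor]
  constructor
  · grind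
  · grind

theorem neighborSet_switch_eq_self {x : V} (ha : x ≠ a) (hb : x ≠ b) (hc : x ≠ c) (hd : x ≠ d) :
    (G.switch a b c d).neighborSet x = G.neighborSet x := by
  ext y
  simp only [mem_neighborSet, switch_adj, Sym2.eq_iff, Xor]
  grind

theorem IsSwitchable.ncard_neighborSet_switch [Finite V] (h : G.IsSwitchable S a b c d) (x : V) :
    ((G.switch a b c d).neighborSet x).ncard = (G.neighborSet x).ncard := by
  obtain ⟨ha, hb, hc, hd, hab, hcd, hac, hbd⟩ := h
  have nac : a ≠ c := fun e => hc (e ▸ ha)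
  have nad : a ≠ d := fun e => hd (e ▸ ha)
  have nbc : b ≠ c := fun e => hc (e ▸ hb)
  have nbd : b ≠ d := fun e => hd (e ▸ hb)
  by_cases hxa : x = a
  · subst hxa
    rw [neighborSet_switch_eq_insert hab nac nad nbc hac]
    exact Set.ncard_exchange hac hab
  by_cases hxb : x = b
  · subst hxb
    rw [← switch_swap_ends, neighborSet_switch_eq_insert hab.symm nbd nbc nad hbd]
    exact Set.ncard_exchange hbd hab.symm
  by_cases hxc : x = c
  · subst hxc
    rw [← switch_swap_pairs, neighborSet_switch_eq_insert hcd nac.symm nbc.symm nad.symm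
      (fun e => hac e.symm)]
    exact Set.ncard_exchange (fun e => hac e.symm) hcd
  by_cases hxd : x = d
  · subst hxd
    rw [← switch_swap_pairs, ← switch_swap_ends, neighborSet_switch_eq_insert hcd.symm nbd.symm
      nad.symm nbc.symm (fun e => hbd e.symm)]
    exact Set.ncard_exchange (fun e => hbd e.symm) hcd.symm
  rw [neighborSet_switch_eq_self hxa hxb hxc hxd]

open Classical in
theorem IsSwitchable.cutPairs_switch [Fintype V] (h : G.IsSwitchable S a b c d) :
    (G.switch a b c d).cutPairs S = insert (a, c) (insert (b, d) (G.cutPairs S)) := by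
  obtain ⟨ha, hb, hc, hd, hab, hcd, hac, hbd⟩ := h
  ext ⟨x, y⟩
  simp only [mem_cutPairs, mem_insert, switch_adj, Sym2.eq_iff, Xor, Prod.mk.injEq]
  constructor <;> grind (splits := 20)

theorem IsSwitchable.card_cutPairs_switch [Fintype V] (h : G.IsSwitchable S a b c d) :
    ((G.switch a b c d).cutPairs S).card = (G.cutPairs S).card + 2 := by
  classical
  rw [h.cutPairs_switch, card_insert_of_notMem, card_insert_of_notMem]
  · simp [mem_cutPairs, h.not_adj_bd]
  · simp [mem_cutPairs, h.not_adj_ac, h.adj_ab.ne]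

open Classical in
/-- The `r`-regular graphs with exactly `k` edges between `S` and its complement. -/
noncomputable def regularWithCut [Fintype V] (r : ℕ) (S : Finset V) (k : ℕ) :
    Finset (SimpleGraph V) :=
  univ.filter fun G => (∀ v, (G.neighborSet v).ncard = r) ∧ (G.cutPairs S).card = k

open Classical in
/-- The number of quadruples at which `G` can be switched. -/
noncomputable def switchings [Fintype V] (G : SimpleGraph V) (S : Finset V) :
    Finset ((V × V) × (V × V)) :=
  univ.filter fun q => G.IsSwitchable S q.1.1 q.1.2 q.2.1 q.2.2

theorem sum_card_switchings_le [Fintype V] (r : ℕ) (S : Finset V) (k : ℕ) :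
    ∑ G ∈ regularWithCut r S k, (G.switchings S).card ≤
      (regularWithCut r S (k + 2)).card * ((k + 2) * (k + 1)) := by
  classical
  let B : Finset (Σ _ : SimpleGraph V, (V × V) × (V × V)) :=
    (regularWithCut r S (k + 2)).sigma fun G => (G.cutPairs S).offDiag
  have hB : B.card = (regularWithCut r S (k + 2)).card * ((k + 2) * (k + 1)) := by
    rw [card_sigma, sum_const_nat]
    intro G hG
    simp only [regularWithCut, mem_filter, mem_univ, true_and] at hG
    rw [offDiag_card, hG.2]
    rw [← Nat.mul_sub_one]
    rfl
  rw [← hB, ← card_sigma]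
  refine card_le_card_of_injOn
    (fun q => ⟨q.1.switch q.2.1.1 q.2.1.2 q.2.2.1 q.2.2.2, (q.2.1.1, q.2.2.1),
      (q.2.1.2, q.2.2.2)⟩) ?_ ?_
  · rintro ⟨G, ⟨a, b⟩, c, d⟩ hq
    simp only [switchings, regularWithCut, coe_sigma, Set.mem_sigma_iff, mem_coe, mem_filter,
      mem_univ, true_and] at hq
    obtain ⟨⟨hr, hk⟩, h⟩ := hq
    simp only [B, regularWithCut, coe_sigma, Set.mem_sigma_iff, mem_coe, mem_filter,
      mem_univ, true_and, mem_offDiag, h.cutPairs_switch]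
    refine ⟨⟨fun v => by rw [h.ncard_neighborSet_switch, hr], by
      rw [← h.cutPairs_switch, h.card_cutPairs_switch, hk]⟩, by simp, by simp, ?_⟩
    simp [h.adj_ab.ne]
  · rintro ⟨G, ⟨a, b⟩, c, d⟩ - ⟨G', ⟨a', b'⟩, c', d'⟩ - he
    simp only [Sigma.mk.injEq, Prod.mk.injEq, heq_eq_eq] at he
    obtain ⟨hG, ⟨rfl, rfl⟩, rfl, rfl⟩ := he
    obtain rfl : G = G' := symmDiff_left_injective _ hG
    rfl

theorem card_filter_adj_ncard [Fintype V] {r : ℕ} (hG : ∀ v, (G.neighborSet v).ncard = r)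
    [∀ v, DecidablePred (G.Adj v)] (v : V) : (univ.filter (G.Adj v)).card = r := by
  rw [← hG v, ← Set.ncard_coe_finset]
  congr 1
  ext
  simp

open Classical in
/-- The ordered pairs of adjacent vertices with both ends in `S`. -/
noncomputable def innerPairs [Fintype V] (G : SimpleGraph V) (S : Finset V) : Finset (V × V) :=
  univ.filter fun p => p.1 ∈ S ∧ p.2 ∈ S ∧ G.Adj p.1 p.2

theorem card_innerPairs_add_card_cutPairs [Fintype V] {r : ℕ}
    (hG : ∀ v, (G.neighborSet v).ncard = r) (S : Finset V) :
    (G.innerPairs S).card + (G.cutPairs S).card = r * S.card := by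
  classical
  have h₁ : (S.sigma fun v => univ.filter (G.Adj v)).card = r * S.card := by
    rw [card_sigma, sum_const_nat (fun v _ => card_filter_adj_ncard hG v), mul_comm]
  have h₂ : Disjoint (G.innerPairs S) (G.cutPairs S) := by
    rw [Finset.disjoint_left]
    intro p hp hp'
    simp only [innerPairs, mem_filter, mem_cutPairs] at hp hp'
    exact hp'.2.1 hp.2.2.1
  rw [← card_union_of_disjoint h₂, ← h₁]
  refine card_bij (fun p _ => ⟨p.1, p.2⟩) ?_ ?_ ?_
  · rintro ⟨x, y⟩ hp
    simp only [innerPairs, mem_union, mem_filter, mem_cutPairs, mem_univ, true_and] at hp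
    simp only [mem_sigma, mem_filter, mem_univ, true_and]
    tauto
  · rintro ⟨x, y⟩ - ⟨x', y'⟩ - h
    simpa using h
  · rintro ⟨x, y⟩ hp
    simp only [mem_sigma, mem_filter, mem_univ, true_and] at hp
    refine ⟨(x, y), ?_, rfl⟩
    simp only [innerPairs, mem_union, mem_filter, mem_cutPairs, mem_univ, true_and]
    tauto

open Classical in
theorem card_cutPairs_compl [Fintype V] (S : Finset V) :
    (G.cutPairs Sᶜ).card = (G.cutPairs S).card := by
  refine card_bij (fun p _ => p.swap) ?_ ?_ ?_
  · rintro ⟨x, y⟩ hp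
    simp only [mem_cutPairs, mem_compl, not_not, Prod.fst_swap, Prod.snd_swap] at hp ⊢
    exact ⟨hp.2.1, hp.1, hp.2.2.symm⟩
  · rintro p - q - h
    exact Prod.swap_injective h
  · rintro ⟨x, y⟩ hp
    simp only [mem_cutPairs] at hp
    refine ⟨(y, x), ?_, rfl⟩
    simp only [mem_cutPairs, mem_compl, not_not]
    exact ⟨hp.2.1, hp.1, hp.2.2.symm⟩

open Classical in
theorem card_innerPairs_mul_le [Fintype V] {r : ℕ} (hG : ∀ v, (G.neighborSet v).ncard = r)
    (S : Finset V) :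
    (G.innerPairs S).card * (G.innerPairs Sᶜ).card ≤
      (G.switchings S).card + 2 * ((G.cutPairs S).card * (r * r)) := by
  let N : V → Finset V := fun v => univ.filter (G.Adj v)
  have hN : ∀ v, (N v).card = r := card_filter_adj_ncard hG
  let C : Finset (Σ _ : V × V, V × V) := (G.cutPairs S).sigma fun p => N p.1 ×ˢ N p.2
  have hC : C.card = (G.cutPairs S).card * (r * r) := by
    rw [card_sigma, sum_const_nat]
    intro p _
    rw [card_product, hN, hN]
  let C₁ := C.image fun q => ((q.1.1, q.2.1), (q.1.2, q.2.2))
  let C₂ := C.image fun q => ((q.2.1, q.1.1), (q.2.2, q.1.2))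
  have hsub : G.innerPairs S ×ˢ G.innerPairs Sᶜ ⊆ G.switchings S ∪ (C₁ ∪ C₂) := by
    rintro ⟨⟨a, b⟩, c, d⟩ h
    simp only [innerPairs, mem_product, mem_filter, mem_univ, true_and, mem_compl] at h
    obtain ⟨⟨ha, hb, hab⟩, hc, hd, hcd⟩ := h
    simp only [mem_union]
    by_cases hac : G.Adj a c
    · refine Or.inr (Or.inl (mem_image.2 ⟨⟨(a, c), (b, d)⟩, ?_, rfl⟩))
      simp [C, N, mem_cutPairs, *]
    by_cases hbd : G.Adj b d
    · refine Or.inr (Or.inr (mem_image.2 ⟨⟨(b, d), (a, c)⟩, ?_, rfl⟩))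
      simp [C, N, mem_cutPairs, hab.symm, hcd.symm, *]
    · left
      simp only [switchings, mem_filter, mem_univ, true_and]
      exact ⟨ha, hb, hc, hd, hab, hcd, hac, hbd⟩
  have h₁ := card_le_card hsub
  have h₂ := card_union_le (G.switchings S) (C₁ ∪ C₂)
  have h₃ := card_union_le C₁ C₂
  have h₄ : C₁.card ≤ C.card := card_image_le
  have h₅ : C₂.card ≤ C.card := card_image_le
  rw [card_product] at h₁
  omega

/-- Switching compares the numbers of regular graphs with `k` and with `k + 2` edges across a
given cut. -/
theorem card_regularWithCut_mul_le [Fintype V] (r : ℕ) (S : Finset V) (k : ℕ) {t : ℕ}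
    (ht : S.card + t = Fintype.card V) :
    ((regularWithCut r S k).card : ℝ) *
        ((r * S.card - k) * (r * t - k) - 2 * k * r ^ 2) ≤
      (regularWithCut r S (k + 2)).card * ((k + 2) * (k + 1)) := by
  classical
  have hcompl : (Sᶜ).card = t := by
    rw [card_compl]
    omega
  have h₁ : ∀ G ∈ regularWithCut r S k,
      ((r * S.card - k) * (r * t - k) - 2 * k * r ^ 2 : ℝ) ≤ (G.switchings S).card := by
    intro G hG
    simp only [regularWithCut, mem_filter, mem_univ, true_and] at hG
    have e₁ := card_innerPairs_add_card_cutPairs hG.1 S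
    have e₂ := card_innerPairs_add_card_cutPairs hG.1 Sᶜ
    rw [card_cutPairs_compl, hG.2, hcompl] at e₂
    rw [hG.2] at e₁
    have e₃ := card_innerPairs_mul_le hG.1 S
    rw [hG.2] at e₃
    have e₁' : ((G.innerPairs S).card : ℝ) = r * S.card - k := by
      rw [eq_sub_iff_add_eq]
      exact_mod_cast e₁
    have e₂' : ((G.innerPairs Sᶜ).card : ℝ) = r * t - k := by
      rw [eq_sub_iff_add_eq]
      exact_mod_cast e₂
    have e₃' : ((G.innerPairs S).card : ℝ) * (G.innerPairs Sᶜ).card ≤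
      (G.switchings S).card + 2 * (k * (r * r)) := by exact_mod_cast e₃
    rw [e₁', e₂'] at e₃'
    linarith
  have h₂ := sum_le_sum h₁
  rw [sum_const, nsmul_eq_mul] at h₂
  refine h₂.trans ?_
  exact_mod_cast sum_card_switchings_le r S k

theorem three_le_card_cutPairs_of_card_le [Fintype V] {r : ℕ} (hr : 3 ≤ r)
    (hG : ∀ v, (G.neighborSet v).ncard = r) {S : Finset V} (hS : S.Nonempty)
    (hcard : S.card ≤ 3) : 3 ≤ (G.cutPairs S).card := by
  classical
  have h₁ := card_innerPairs_add_card_cutPairs hG S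
  have h₂ : (G.innerPairs S).card ≤ S.card * S.card - S.card := by
    rw [← offDiag_card]
    refine card_le_card fun p hp => ?_
    simp only [innerPairs, mem_filter, mem_univ, true_and] at hp
    exact mem_offDiag.2 ⟨hp.1, hp.2.1, hp.2.2.ne⟩
  have h₃ := hS.card_pos
  interval_cases S.card <;> omega

end SimpleGraph

section Estimates

/-- The factor by which a switching increases the number of graphs, up to lower-order terms. -/
noncomputable def switchRatio (s t : ℝ) (i : ℕ) : ℝ :=
  ((2 * i + 4) * (2 * i + 3)) / ((3 * s - 2 * i - 2) * (3 * t - 2 * i - 2))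

theorem switchRatio_nonneg {s t : ℝ} {i : ℕ} (hs : 4 ≤ s) (hst : s ≤ t) (hi : (i : ℝ) ≤ s) :
    0 ≤ switchRatio s t i := by
  have h₁ : 0 < 3 * s - 2 * i - 2 := by linarith
  have h₂ : 0 < 3 * t - 2 * i - 2 := by linarith
  unfold switchRatio
  positivity

theorem le_exp_mul_switchRatio_mul {r s t k x y : ℝ} {i : ℕ} (hr : 3 ≤ r) (hs : 4 ≤ s)
    (hst : s ≤ t) (ht : 40 * r ^ 2 ≤ t) (hi : (i : ℝ) ≤ s) (hk : 0 ≤ k) (hki : k ≤ 2 * i + 2)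
    (hx : 0 ≤ x) (hy : 0 ≤ y)
    (h : x * ((r * s - k) * (r * t - k) - 2 * k * r ^ 2) ≤ y * ((k + 2) * (k + 1))) :
    x ≤ Real.exp (40 * r ^ 2 / t) * switchRatio s t i * y := by
  have ht0 : 0 < t := by linarith
  have h₁ : s / 2 ≤ 3 * s - 2 * i - 2 := by linarith
  have h₂ : t / 2 ≤ 3 * t - 2 * i - 2 := by linarith
  have h₁' : 3 * s - 2 * i - 2 ≤ r * s - k := by nlinarith
  have h₂' : 3 * t - 2 * i - 2 ≤ r * t - k := by nlinarith
  set A := 3 * s - 2 * i - 2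
  set B := 3 * t - 2 * i - 2
  have hA : 0 < A := by linarith
  have hB : 0 < B := by linarith
  set δ := 20 * r ^ 2 / t with hδ
  have hδ0 : 0 ≤ δ := by positivity
  have hδ1 : δ ≤ 1 / 2 := by
    rw [hδ, div_le_iff₀ ht0]
    linarith
  have hexp : 40 * r ^ 2 / t = 2 * δ := by rw [hδ]; ring
  have hE : 1 ≤ (1 - δ) * Real.exp (2 * δ) := by
    have := Real.add_one_le_exp (2 * δ)
    nlinarith
  have hδAB : 5 * s * r ^ 2 ≤ δ * (A * B) := by
    have : (s / 2) * (t / 2) ≤ A * B := mul_le_mul h₁ h₂ (by positivity) hA.le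
    calc 5 * s * r ^ 2 = δ * ((s / 2) * (t / 2)) := by rw [hδ]; field_simp; ring
      _ ≤ δ * (A * B) := by gcongr
  have hkr : 2 * k * r ^ 2 ≤ 5 * s * r ^ 2 := by
    have : 2 * k ≤ 5 * s := by linarith
    gcongr
  have hprod : A * B ≤ (r * s - k) * (r * t - k) := mul_le_mul h₁' h₂' hB.le (by linarith)
  have hmain : (1 - δ) * (A * B) ≤ (r * s - k) * (r * t - k) - 2 * k * r ^ 2 := by linarith
  rw [hexp, switchRatio, mul_div_assoc', div_mul_eq_mul_div, le_div_iff₀ (by positivity)]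
  calc x * (A * B) = 1 * (x * (A * B)) := by ring
    _ ≤ ((1 - δ) * Real.exp (2 * δ)) * (x * (A * B)) := by gcongr
    _ = Real.exp (2 * δ) * (x * ((1 - δ) * (A * B))) := by ring
    _ ≤ Real.exp (2 * δ) * (y * ((k + 2) * (k + 1))) := by
      have := (mul_le_mul_of_nonneg_left hmain hx).trans h
      gcongr
    _ ≤ Real.exp (2 * δ) * (y * ((2 * i + 4) * (2 * i + 3))) := by
      have : (k + 2) * (k + 1) ≤ (2 * i + 4) * (2 * i + 3) :=
        mul_le_mul (by linarith) (by linarith) (by linarith) (by positivity)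
      gcongr
    _ = _ := by ring

theorem le_prod_switchRatio_mul {r s t : ℕ} (hr : 3 ≤ r) (hs : 4 ≤ s) (hst : s ≤ t)
    (ht : 40 * r ^ 2 ≤ t) {N : ℕ → ℝ} {M : ℝ} (hN : ∀ k, 0 ≤ N k) (hM : ∀ k, N k ≤ M)
    (h : ∀ k : ℕ, N k * ((r * s - k) * (r * t - k) - 2 * k * r ^ 2) ≤
      N (k + 2) * ((k + 2) * (k + 1))) {k : ℕ} (hk : k ≤ 2) :
    N k ≤ Real.exp (80 * r ^ 2) * (∏ i ∈ range (s + 1), switchRatio s t i) * M := by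
  have hr' : (3 : ℝ) ≤ r := by exact_mod_cast hr
  have hs' : (4 : ℝ) ≤ s := by exact_mod_cast hs
  have hst' : (s : ℝ) ≤ t := by exact_mod_cast hst
  have ht' : 40 * (r : ℝ) ^ 2 ≤ t := by exact_mod_cast ht
  have ht0 : (0 : ℝ) < t := by linarith
  have key : ∀ j ≤ s + 1, N k ≤ Real.exp (40 * r ^ 2 / t) ^ j *
      (∏ i ∈ range j, switchRatio s t i) * N (k + 2 * j) := by
    intro j
    induction j with
    | zero => simp
    | succ j ih =>
      intro hj
      have hj' : (j : ℝ) ≤ s := by exact_mod_cast (by omega : j ≤ s)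
      have hpos : 0 ≤ ∏ i ∈ range j, switchRatio s t i := prod_nonneg fun i hi =>
        switchRatio_nonneg hs' hst' (le_trans (by exact_mod_cast (mem_range.1 hi).le) hj')
      have hkj : ((k + 2 * j : ℕ) : ℝ) ≤ 2 * j + 2 := by exact_mod_cast (by omega)
      have := le_exp_mul_switchRatio_mul hr' hs' hst' ht' hj' (Nat.cast_nonneg (k + 2 * j)) hkj
        (hN _) (hN _) (h (k + 2 * j))
      refine (ih (by omega)).trans ((mul_le_mul_of_nonneg_left this (by positivity)).trans_eq ?_)
      rw [prod_range_succ, pow_succ, show k + 2 * (j + 1) = k + 2 * j + 2 by ring]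
      ring
  have hpos : 0 ≤ ∏ i ∈ range (s + 1), switchRatio s t i := prod_nonneg fun i hi =>
    switchRatio_nonneg hs' hst' (by exact_mod_cast Nat.lt_succ_iff.1 (mem_range.1 hi))
  have hM0 : 0 ≤ M := (hN 0).trans (hM 0)
  have hE : Real.exp (40 * r ^ 2 / t) ^ (s + 1) ≤ Real.exp (80 * r ^ 2) := by
    rw [← Real.exp_nat_mul, Real.exp_le_exp, mul_div_assoc', div_le_iff₀ ht0]
    push_cast
    have : (s : ℝ) + 1 ≤ 2 * t := by linarith
    nlinarith [sq_nonneg (r : ℝ)]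
  calc N k ≤ _ := key (s + 1) le_rfl
    _ ≤ Real.exp (40 * r ^ 2 / t) ^ (s + 1) * (∏ i ∈ range (s + 1), switchRatio s t i) * M := by
      gcongr
      exact hM _
    _ ≤ _ := by gcongr

open Nat in
theorem factorial_le_mul_prod_sq (n j : ℕ) (h : 2 * j ≤ n) :
    (n ! : ℝ) ≤ (n - 2 * j)! * ∏ i ∈ range j, ((n : ℝ) - 2 * i) ^ 2 := by
  induction j with
  | zero => simp
  | succ j ih =>
    refine (ih (by omega)).trans ?_
    obtain ⟨m, hm⟩ : ∃ m, n = m + 2 * (j + 1) := ⟨n - 2 * (j + 1), by omega⟩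
    have e₁ : n - 2 * j = m + 2 := by omega
    have e₂ : n - 2 * (j + 1) = m := by omega
    have e₃ : (n : ℝ) - 2 * j = m + 2 := by rw [hm]; push_cast; ring
    rw [e₁, e₂, prod_range_succ, e₃, Nat.factorial_succ, Nat.factorial_succ]
    push_cast
    have hP : 0 ≤ ∏ i ∈ range j, ((n : ℝ) - 2 * i) ^ 2 := prod_nonneg fun i _ => sq_nonneg _
    have : ((m : ℝ) + 1 + 1) * ((m + 1) * m !) ≤ m ! * (m + 2) ^ 2 := by
      have : (0 : ℝ) ≤ m ! := by positivity
      nlinarith [this, (Nat.cast_nonneg m : (0 : ℝ) ≤ m)]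
    calc _ ≤ ((m ! : ℝ) * ((m : ℝ) + 2) ^ 2) * ∏ i ∈ range j, ((n : ℝ) - 2 * i) ^ 2 := by gcongr
      _ = _ := by ring

open Nat in
theorem factorial_quotient_le_geometric (m : ℕ) :
    ((2 * m + 6)! * (2 * m + 4)! * m ! : ℝ) ≤
      180 * (9 / 10) ^ m * (((m + 2)! : ℝ) ^ 2 * (3 * m + 4)!) := by
  induction m with
  | zero => norm_num [Nat.factorial]
  | succ m ih =>
    have e₁ : ((2 * (m + 1) + 6)! : ℝ) = (2 * m + 8) * (2 * m + 7) * (2 * m + 6)! := by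
      rw [show 2 * (m + 1) + 6 = 2 * m + 6 + 1 + 1 by ring, factorial_succ, factorial_succ]
      push_cast
      ring
    have e₂ : ((2 * (m + 1) + 4)! : ℝ) = (2 * m + 6) * (2 * m + 5) * (2 * m + 4)! := by
      rw [show 2 * (m + 1) + 4 = 2 * m + 4 + 1 + 1 by ring, factorial_succ, factorial_succ]
      push_cast
      ring
    have e₃ : ((m + 1)! : ℝ) = (m + 1) * m ! := by
      rw [factorial_succ]
      push_cast
      ring
    have e₄ : ((m + 1 + 2)! : ℝ) = (m + 3) * (m + 2)! := by
      rw [show m + 1 + 2 = m + 2 + 1 by ring, factorial_succ]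
      push_cast
      ring
    have e₅ : ((3 * (m + 1) + 4)! : ℝ) =
        (3 * m + 7) * (3 * m + 6) * (3 * m + 5) * (3 * m + 4)! := by
      rw [show 3 * (m + 1) + 4 = 3 * m + 4 + 1 + 1 + 1 by ring, factorial_succ, factorial_succ,
        factorial_succ]
      push_cast
      ring
    rw [e₁, e₂, e₃, e₄, e₅]
    have hm : (0 : ℝ) ≤ m := Nat.cast_nonneg m
    have hpoly : (2 * m + 8) * (2 * m + 7) * ((2 * m + 6) * (2 * m + 5)) * (m + 1) ≤
        9 / 10 * ((m + 3 : ℝ) ^ 2 * ((3 * m + 7) * (3 * m + 6) * (3 * m + 5))) := by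
      have : 0 ≤ 83 * (m : ℝ) ^ 4 + 427 * m ^ 3 + (423 * m ^ 2 - 283 * m + 70) := by
        have : 0 ≤ 423 * (m : ℝ) ^ 2 - 283 * m + 70 := by nlinarith [sq_nonneg ((m : ℝ) - 1 / 3)]
        positivity
      nlinarith [mul_nonneg (by linarith : (0 : ℝ) ≤ m + 3) this]
    calc _ = ((2 * m + 8) * (2 * m + 7) * ((2 * m + 6) * (2 * m + 5)) * (m + 1) : ℝ) *
          ((2 * m + 6)! * (2 * m + 4)! * m !) := by ring
      _ ≤ 9 / 10 * ((m + 3 : ℝ) ^ 2 * ((3 * m + 7) * (3 * m + 6) * (3 * m + 5))) *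
          (180 * (9 / 10) ^ m * (((m + 2)! : ℝ) ^ 2 * (3 * m + 4)!)) := by gcongr
      _ = _ := by ring

open Nat in
theorem prod_two_mul_add_range (s : ℕ) :
    ∏ i ∈ range s, ((2 * i + 4 : ℝ) * (2 * i + 3)) = (2 * s + 2)! / 2 := by
  induction s with
  | zero => norm_num [Nat.factorial]
  | succ s ih =>
    have : (2 * (s + 1) + 2)! = (2 * s + 4) * ((2 * s + 3) * (2 * s + 2)!) := rfl
    rw [prod_range_succ, ih, this]
    push_cast
    ring

open Nat in
theorem choose_mul_prod_switchRatio_le {s t : ℕ} (hs : 4 ≤ s) (hst : s ≤ t) :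
    ((s + t).choose s : ℝ) * ∏ i ∈ range (s + 1), switchRatio s t i ≤
      6000 * (s * (9 / 10) ^ s) / t := by
  have hs' : (4 : ℝ) ≤ s := by exact_mod_cast hs
  have hst' : (s : ℝ) ≤ t := by exact_mod_cast hst
  have ht0 : (0 : ℝ) < t := by linarith
  have hchoose : ∀ u : ℕ, ((s + u).choose s : ℝ) = (∏ i ∈ range s, ((u : ℝ) + i + 1)) / s ! := by
    intro u
    have := ascFactorial_eq_factorial_mul_choose u s
    rw [ascFactorial_eq_prod_range] at this
    rw [eq_div_iff (by positivity), add_comm s u, mul_comm]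
    rw [← Nat.cast_mul, ← this]
    push_cast
    exact prod_congr rfl fun i _ => by ring
  have hlast : switchRatio s t s ≤ 36 * s / t := by
    unfold switchRatio
    rw [div_le_div_iff₀ (mul_pos (by linarith) (by linarith)) ht0]
    have h₁ : (s / 2 : ℝ) * (t / 2) ≤ (3 * s - 2 * s - 2) * (3 * t - 2 * s - 2) :=
      mul_le_mul (by linarith) (by linarith) (by positivity) (by linarith)
    have h₂ : (2 * s + 4 : ℝ) * (2 * s + 3) ≤ (3 * s) * (3 * s) :=
      mul_le_mul (by linarith) (by linarith) (by linarith) (by linarith)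
    calc (2 * s + 4 : ℝ) * (2 * s + 3) * t ≤ (3 * s) * (3 * s) * t := by gcongr
      _ = 36 * s * ((s / 2 : ℝ) * (t / 2)) := by ring
      _ ≤ _ := by gcongr
  have hfactor : ∀ i ∈ range s, ((t : ℝ) + i + 1) * switchRatio s t i ≤
      (2 * i + 4) * (2 * i + 3) * ((s : ℝ) + i + 1) / ((3 * s - 2 : ℕ) - 2 * i : ℝ) ^ 2 := by
    intro i hi
    have hi' : (i : ℝ) + 1 ≤ s := by exact_mod_cast mem_range.1 hi
    have hcast : ((3 * s - 2 : ℕ) : ℝ) = 3 * s - 2 := by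
      rw [Nat.cast_sub (by omega)]
      push_cast
      ring
    have hA : (0 : ℝ) < 3 * s - 2 * i - 2 := by linarith
    have hB : (0 : ℝ) < 3 * t - 2 * i - 2 := by linarith
    have h₁ : ((t : ℝ) + i + 1) * (3 * s - 2 * i - 2) ≤ (s + i + 1) * (3 * t - 2 * i - 2) := by
      nlinarith
    rw [hcast, show (3 * s - 2 - 2 * i : ℝ) = 3 * s - 2 * i - 2 by ring, switchRatio,
      mul_div_assoc', div_le_div_iff₀ (by positivity) (by positivity)]
    calc _ = (2 * i + 4) * (2 * i + 3) * (3 * s - 2 * i - 2) *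
          (((t : ℝ) + i + 1) * (3 * s - 2 * i - 2)) := by ring
      _ ≤ (2 * i + 4) * (2 * i + 3) * (3 * s - 2 * i - 2) *
          ((s + i + 1) * (3 * t - 2 * i - 2)) := by gcongr
      _ = _ := by ring
  have hnonneg : ∀ i ∈ range s, 0 ≤ ((t : ℝ) + i + 1) * switchRatio s t i := fun i hi =>
    mul_nonneg (by positivity)
      (switchRatio_nonneg hs' hst' (by exact_mod_cast (mem_range.1 hi).le))
  obtain ⟨m, rfl⟩ : ∃ m, s = m + 2 := ⟨s - 2, by omega⟩
  have hR : (∏ i ∈ range (m + 2), ((t : ℝ) + i + 1) * switchRatio (m + 2 : ℕ) t i) /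
      (m + 2)! ≤ 90 * (9 / 10) ^ m := by
    have h₁ := prod_le_prod hnonneg hfactor
    rw [prod_div_distrib, prod_mul_distrib (g := fun i : ℕ => ((m + 2 : ℕ) : ℝ) + i + 1),
      prod_two_mul_add_range] at h₁
    have h₂ := hchoose (m + 2)
    rw [eq_div_iff (by positivity)] at h₂
    have h₃ : ((m + 2 + (m + 2)).choose (m + 2) : ℝ) * (m + 2)! * (m + 2)! = (2 * m + 4)! := by
      have := add_choose_mul_factorial_mul_factorial (m + 2) (m + 2)
      rw [show m + 2 + (m + 2) = 2 * m + 4 by ring] at this ⊢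
      exact_mod_cast this
    have h₄ := factorial_le_mul_prod_sq (3 * (m + 2) - 2) (m + 2) (by omega)
    rw [show 3 * (m + 2) - 2 - 2 * (m + 2) = m by omega] at h₄
    have h₅ := factorial_quotient_le_geometric m
    rw [show 3 * m + 4 = 3 * (m + 2) - 2 by omega] at h₅
    set Q := ∏ i ∈ range (m + 2), (((3 * (m + 2) - 2 : ℕ) : ℝ) - 2 * i) ^ 2
    rw [← h₂] at h₁
    have hQ : 0 < Q := by
      have : (0 : ℝ) < (3 * (m + 2) - 2)! := by positivity
      exact pos_of_mul_pos_right (this.trans_le h₄) (by positivity)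
    rw [le_div_iff₀ hQ, show 2 * (m + 2) + 2 = 2 * m + 6 by ring] at h₁
    rw [div_le_iff₀ (by positivity)]
    set P := ∏ i ∈ range (m + 2), ((t : ℝ) + i + 1) * switchRatio (m + 2 : ℕ) t i
    have hF : (0 : ℝ) < (m + 2)! := by positivity
    have hG : (0 : ℝ) < m ! := by positivity
    refine le_of_mul_le_mul_right ?_ (mul_pos (mul_pos hQ hF) hG)
    calc P * (Q * (m + 2)! * m !) = P * Q * ((m + 2)! * m !) := by ring
      _ ≤ ((2 * m + 6)! / 2 * (((m + 2 + (m + 2)).choose (m + 2) : ℝ) * (m + 2)!)) *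
          ((m + 2)! * m !) := by gcongr
      _ = (2 * m + 6)! * (((m + 2 + (m + 2)).choose (m + 2) : ℝ) * (m + 2)! * (m + 2)!) *
          m ! / 2 := by
        ring
      _ ≤ (180 * (9 / 10) ^ m * (((m + 2)! : ℝ) ^ 2 * (3 * (m + 2) - 2)!)) / 2 := by
        rw [h₃]
        gcongr
      _ ≤ (180 * (9 / 10) ^ m * (((m + 2)! : ℝ) ^ 2 * (m ! * Q))) / 2 := by gcongr
      _ = _ := by ring
  rw [prod_range_succ, hchoose]
  have hl0 := switchRatio_nonneg hs' hst' le_rfl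
  calc _ = ((∏ i ∈ range (m + 2), ((t : ℝ) + i + 1) * switchRatio (m + 2 : ℕ) t i) /
        (m + 2)!) * switchRatio (m + 2 : ℕ) t (m + 2) := by
        rw [prod_mul_distrib]
        ring
    _ ≤ 90 * (9 / 10) ^ m * (36 * (m + 2 : ℕ) / t) := by gcongr
    _ = 4000 * ((m + 2 : ℕ) * (9 / 10) ^ (m + 2)) / t := by ring
    _ ≤ _ := by gcongr; norm_num

end Estimates

namespace SimpleGraph

theorem exists_regularWithCut_of_small_cut {V : Type*} [Fintype V] {G : SimpleGraph V} {r : ℕ}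
    (hr : 3 ≤ r) (hG : ∀ v, (G.neighborSet v).ncard = r) {S : Finset V} (hS : S.Nonempty)
    (hS' : S ≠ univ) (hcut : (G.cutPairs S).card < 3) :
    ∃ s ∈ Icc 4 (Fintype.card V / 2), ∃ S ∈ powersetCard s univ, ∃ k ∈ range 3,
      G ∈ regularWithCut r S k := by
  classical
  have key : ∀ T : Finset V, T.Nonempty → (G.cutPairs T).card < 3 →
      2 * T.card ≤ Fintype.card V → ∃ s ∈ Icc 4 (Fintype.card V / 2),
        ∃ S ∈ powersetCard s univ, ∃ k ∈ range 3, G ∈ regularWithCut r S k := by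
    intro T hT hcut hcard
    have h4 : 4 ≤ T.card := by
      by_contra! h
      have := three_le_card_cutPairs_of_card_le hr hG hT (by omega)
      omega
    exact ⟨T.card, mem_Icc.2 ⟨h4, by omega⟩, T, by simp, _, mem_range.2 hcut, by
      simp [regularWithCut, hG]⟩
  by_cases h : 2 * S.card ≤ Fintype.card V
  · exact key S hS hcut h
  · refine key Sᶜ ?_ (by rwa [card_cutPairs_compl]) ?_
    · rwa [nonempty_iff_ne_empty, Ne, compl_eq_empty_iff]
    · rw [card_compl]
      omega

theorem card_regularWithCut_mul_choose_le {V : Type*} [Fintype V] {r s : ℕ} (hr : 3 ≤ r)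
    (hs : 4 ≤ s) (hsV : 2 * s ≤ Fintype.card V) (hV : 80 * r ^ 2 ≤ Fintype.card V)
    {R : Finset (SimpleGraph V)} (hR : ∀ G, G ∈ R ↔ ∀ v, (G.neighborSet v).ncard = r)
    {k : ℕ} (hk : k ≤ 2) :
    ∑ S ∈ powersetCard s (univ : Finset V), ((regularWithCut r S k).card : ℝ) ≤
      12000 * Real.exp (80 * r ^ 2) * (s * (9 / 10) ^ s) / Fintype.card V * R.card := by
  obtain ⟨t, ht⟩ : ∃ t, s + t = Fintype.card V := ⟨Fintype.card V - s, by omega⟩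
  have hn : (0 : ℝ) < Fintype.card V := by exact_mod_cast (by omega)
  have hnt : (Fintype.card V : ℝ) / 2 ≤ t := by
    rw [div_le_iff₀ two_pos]
    exact_mod_cast (by omega)
  have h₁ : ∀ S ∈ powersetCard s (univ : Finset V), ((regularWithCut r S k).card : ℝ) ≤
      Real.exp (80 * r ^ 2) * (∏ i ∈ range (s + 1), switchRatio s t i) * R.card := by
    intro S hS
    have hSs := (mem_powersetCard.1 hS).2
    refine le_prod_switchRatio_mul (N := fun k => ((regularWithCut r S k).card : ℝ)) hr hs
      (by omega) (by omega) (fun _ => Nat.cast_nonneg _) (fun j => ?_) (fun j => ?_) hk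
    · refine Nat.cast_le.2 (card_le_card fun G hG => (hR G).2 ?_)
      simp only [regularWithCut, mem_filter] at hG
      exact hG.2.1
    · rw [← hSs]
      exact card_regularWithCut_mul_le r S j (by rw [hSs, ht])
  refine (sum_le_card_nsmul _ _ _ h₁).trans ?_
  rw [card_powersetCard, card_univ, nsmul_eq_mul, ← ht]
  have h₂ := choose_mul_prod_switchRatio_le hs (by omega : s ≤ t)
  calc _ = Real.exp (80 * r ^ 2) *
        (((s + t).choose s : ℝ) * ∏ i ∈ range (s + 1), switchRatio s t i) * R.card := by ring
    _ ≤ Real.exp (80 * r ^ 2) * (6000 * (s * (9 / 10) ^ s) / t) * R.card := by gcongr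
    _ ≤ Real.exp (80 * r ^ 2) * (6000 * (s * (9 / 10) ^ s) / (Fintype.card V / 2)) *
        R.card := by gcongr
    _ = _ := by
      rw [ht]
      ring

/-- The proportion of `r`-regular graphs having a cut with fewer than three edges is at most
`C / n`. -/
theorem card_le_of_forall_exists_small_cut {V : Type*} [Fintype V] {r : ℕ} (hr : 3 ≤ r)
    (hV : 80 * r ^ 2 ≤ Fintype.card V) {R B : Finset (SimpleGraph V)}
    (hR : ∀ G, G ∈ R ↔ ∀ v, (G.neighborSet v).ncard = r)
    (hB : ∀ G ∈ B, G ∈ R ∧ ∃ S : Finset V, S.Nonempty ∧ S ≠ univ ∧ (G.cutPairs S).card < 3) :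
    (B.card : ℝ) ≤ 36000 * Real.exp (80 * r ^ 2) * (∑' s : ℕ, s * (9 / 10 : ℝ) ^ s) /
      Fintype.card V * R.card := by
  classical
  let I := Icc 4 (Fintype.card V / 2)
  have hsub : B ⊆ I.biUnion fun s => (powersetCard s univ).biUnion fun S =>
      (range 3).biUnion fun k => regularWithCut r S k := by
    intro G hG
    obtain ⟨hGR, S, hS, hS', hcut⟩ := hB G hG
    simpa only [mem_biUnion, I] using
      exists_regularWithCut_of_small_cut hr ((hR G).1 hGR) hS hS' hcut
  have h₁ : B.card ≤ ∑ s ∈ I, ∑ S ∈ powersetCard s univ, ∑ k ∈ range 3,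
      (regularWithCut r S k).card :=
    (card_le_card hsub).trans <| card_biUnion_le.trans <| sum_le_sum fun s _ =>
      card_biUnion_le.trans <| sum_le_sum fun S _ => card_biUnion_le
  have h₂ : ∀ s ∈ I, ∑ S ∈ powersetCard s (univ : Finset V), ∑ k ∈ range 3,
      ((regularWithCut r S k).card : ℝ) ≤
        3 * (12000 * Real.exp (80 * r ^ 2) * (s * (9 / 10) ^ s) / Fintype.card V * R.card) := by
    intro s hs
    obtain ⟨hs4, hsn⟩ := mem_Icc.1 hs
    rw [sum_comm]
    refine (sum_le_card_nsmul _ _ _ fun k hk => card_regularWithCut_mul_choose_le hr hs4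
      (by omega) hV hR (Nat.lt_succ_iff.1 (mem_range.1 hk))).trans_eq ?_
    simp
  have hsum : Summable fun s : ℕ => s * (9 / 10 : ℝ) ^ s := by
    simpa using summable_pow_mul_geometric_of_norm_lt_one 1
      (r := (9 / 10 : ℝ)) (by rw [Real.norm_eq_abs, abs_of_pos] <;> norm_num)
  calc (B.card : ℝ) ≤ ∑ s ∈ I, ∑ S ∈ powersetCard s (univ : Finset V), ∑ k ∈ range 3,
        ((regularWithCut r S k).card : ℝ) := by exact_mod_cast h₁
    _ ≤ ∑ s ∈ I, 3 * (12000 * Real.exp (80 * r ^ 2) * (s * (9 / 10) ^ s) /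
        Fintype.card V * R.card) := sum_le_sum h₂
    _ = 36000 * Real.exp (80 * r ^ 2) * (∑ s ∈ I, s * (9 / 10 : ℝ) ^ s) / Fintype.card V *
        R.card := by
      simp only [mul_sum, sum_div, sum_mul]
      exact sum_congr rfl fun s _ => by ring
    _ ≤ _ := by
      have := hsum.sum_le_tsum I fun s _ => by positivity
      gcongr

theorem exists_not_adj_of_ncard_neighborSet {V : Type*} [Fintype V] [Nonempty V]
    {G : SimpleGraph V} {r : ℕ} (hG : ∀ v, (G.neighborSet v).ncard = r)
    (hV : r + 2 ≤ Fintype.card V) : ∃ u v, u ≠ v ∧ ¬ G.Adj u v := by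
  obtain ⟨u⟩ := ‹Nonempty V›
  by_contra! h
  have h₁ : (Set.univ : Set V) ⊆ insert u (G.neighborSet u) := fun v _ => by
    by_cases hv : v = u
    · exact Or.inl hv
    · exact Or.inr (h u v (Ne.symm hv))
  have h₂ := Set.ncard_le_ncard h₁
  have h₃ := Set.ncard_insert_le u (G.neighborSet u)
  rw [Set.ncard_univ, Nat.card_eq_fintype_card] at h₂
  rw [hG] at h₃
  omega

theorem ncard_neighborSet_circulantGraph {A : Type*} [AddCommGroup A] {s : Set A}
    (h0 : (0 : A) ∉ s) (hneg : ∀ x ∈ s, -x ∈ s) (v : A) :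
    ((circulantGraph s).neighborSet v).ncard = s.ncard := by
  rw [← Set.ncard_image_of_injective s (sub_right_injective (b := v))]
  congr 1
  ext w
  simp only [mem_neighborSet, circulantGraph_adj, Set.mem_image]
  constructor
  · rintro ⟨-, h | h⟩
    · exact ⟨v - w, h, by abel⟩
    · exact ⟨-(w - v), hneg _ h, by abel⟩
  · rintro ⟨x, hx, rfl⟩
    refine ⟨fun h => h0 ?_, Or.inl (by simpa using hx)⟩
    rwa [show x = 0 by simpa using h.symm] at hx

theorem exists_regular {r n : ℕ} (hn : r < n) (hrn : Even (r * n)) :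
    ∃ G : SimpleGraph (Fin n), ∀ v, (G.neighborSet v).ncard = r := by
  have : NeZero n := ⟨by omega⟩
  let T : Finset ℕ :=
    (Icc 1 (r / 2) ∪ Icc (n - r / 2) (n - 1)) ∪ if r % 2 = 0 then ∅ else {n / 2}
  have hmem : ∀ x, x ∈ T ↔ (1 ≤ x ∧ x ≤ r / 2) ∨ (n - r / 2 ≤ x ∧ x ≤ n - 1) ∨
      (r % 2 = 1 ∧ x = n / 2) := by
    intro x
    simp only [T, mem_union, mem_Icc]
    split_ifs with h <;> simp <;> omega
  have hpar : r % 2 = 1 → n % 2 = 0 := by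
    intro h
    rcases Nat.even_mul.1 hrn with h' | h'
    · rw [Nat.even_iff] at h'
      omega
    · exact Nat.even_iff.1 h'
  have hcard : T.card = r := by
    have h₁ : Disjoint (Icc 1 (r / 2)) (Icc (n - r / 2) (n - 1)) := by
      rw [Finset.disjoint_left]
      intro x hx hx'
      rw [mem_Icc] at hx hx'
      omega
    have h₂ : Disjoint (Icc 1 (r / 2) ∪ Icc (n - r / 2) (n - 1))
        (if r % 2 = 0 then ∅ else {n / 2}) := by
      rw [Finset.disjoint_left]
      intro x hx hx'
      rw [mem_union, mem_Icc, mem_Icc] at hx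
      split_ifs at hx' with h
      · simp at hx'
      · have := hpar (by omega)
        rw [mem_singleton] at hx'
        omega
    rw [card_union_of_disjoint h₂, card_union_of_disjoint h₁, Nat.card_Icc, Nat.card_Icc]
    split_ifs <;> simp <;> omega
  let s : Set (Fin n) := {x | x.val ∈ T}
  refine ⟨circulantGraph s, fun v => ?_⟩
  rw [ncard_neighborSet_circulantGraph]
  · rw [← hcard, ← Set.ncard_coe_finset T, ← Set.ncard_image_of_injective s Fin.val_injective]
    congr 1
    ext x
    simp only [s, Set.mem_image, Set.mem_ofPred_eq, mem_coe]
    constructor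
    · rintro ⟨y, hy, rfl⟩
      exact hy
    · intro hx
      have := (hmem x).1 hx
      exact ⟨⟨x, by omega⟩, hx, rfl⟩
  · intro h
    have := (hmem _).1 h
    rw [Fin.val_zero] at this
    omega
  · intro x hx
    have h₁ := (hmem _).1 hx
    have h₂ := x.isLt
    refine (hmem _).2 ?_
    rw [Fin.val_neg']
    rw [Nat.mod_eq_of_lt (by omega)]
    by_cases h : r % 2 = 1
    · have := hpar h
      omega
    · omega

end SimpleGraph

theorem card_div_card_bounds {r n : ℕ} (hr : 3 ≤ r) (hn : 80 * r ^ 2 ≤ n) (hrn : Even (r * n))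
    {R A : Finset (SimpleGraph (Fin n))} (hR : ∀ G, G ∈ R ↔ ∀ v, (G.neighborSet v).ncard = r)
    (hA : ∀ G, G ∈ A ↔ (∀ v, (G.neighborSet v).ncard = r) ∧ properConnectionNumber G = 2) :
    1 - 36000 * Real.exp (80 * r ^ 2) * (∑' s : ℕ, s * (9 / 10 : ℝ) ^ s) / n ≤
      (A.card : ℝ) / R.card ∧ (A.card : ℝ) / R.card ≤ 1 := by
  classical
  have hrn' : r + 2 ≤ n := by nlinarith
  have : NeZero n := ⟨by omega⟩
  obtain ⟨G₀, hG₀⟩ := SimpleGraph.exists_regular (by omega : r < n) hrn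
  have hAR : A ⊆ R := fun G hG => (hR G).2 ((hA G).1 hG).1
  have hpos : (0 : ℝ) < R.card := by
    exact_mod_cast card_pos.2 ⟨G₀, (hR G₀).2 hG₀⟩
  have hbad := SimpleGraph.card_le_of_forall_exists_small_cut (V := Fin n) (R := R) (B := R \ A) hr
    (by simpa using hn) hR fun G hG => by
      rw [mem_sdiff] at hG
      refine ⟨hG.1, ?_⟩
      by_contra! hcut
      obtain ⟨u, v, huv, hadj⟩ := SimpleGraph.exists_not_adj_of_ncard_neighborSet
        ((hR G).1 hG.1) (by simpa using hrn')
      exact hG.2 ((hA G).2 ⟨(hR G).1 hG.1, properConnectionNumber_eq_two G hcut huv hadj⟩)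
  rw [Fintype.card_fin, cast_card_sdiff hAR] at hbad
  refine ⟨?_, (div_le_one hpos).2 (by exact_mod_cast card_le_card hAR)⟩
  rw [le_div_iff₀ hpos]
  linarith

theorem regularProportion_bounds {r n : ℕ} (hr : 3 ≤ r) (hn : 80 * r ^ 2 ≤ n)
    (hrn : Even (r * n)) :
    1 - 36000 * Real.exp (80 * r ^ 2) * (∑' s : ℕ, s * (9 / 10 : ℝ) ^ s) / n ≤
        regularProportion r n (fun G => properConnectionNumber G = 2) ∧
      regularProportion r n (fun G => properConnectionNumber G = 2) ≤ 1 := by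
  unfold regularProportion
  exact card_div_card_bounds hr hn hrn (by simp) (by simp)

/-- For each fixed integer `r ≥ 3`, almost all `r`-regular graphs have proper connection
number 2, as `n → ∞` along those `n` with `r * n` even and `n ≥ r + 1`. -/
theorem almost_all_regular_graphs_pc_eq_two (r : ℕ) (hr : 3 ≤ r) :
    Filter.Tendsto
      (fun n => regularProportion r n (fun G => properConnectionNumber G = 2))
      (Filter.atTop ⊓ Filter.principal {n : ℕ | Even (r * n) ∧ r + 1 ≤ n}) (nhds 1) := by
  have hlim : Filter.Tendsto (fun n : ℕ => 1 - 36000 * Real.exp (80 * r ^ 2) *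
      (∑' s : ℕ, s * (9 / 10 : ℝ) ^ s) / n)
      (Filter.atTop ⊓ Filter.principal {n : ℕ | Even (r * n) ∧ r + 1 ≤ n}) (nhds 1) := by
    simpa using ((tendsto_const_div_atTop_nhds_zero_nat (36000 * Real.exp (80 * r ^ 2) *
      ∑' s : ℕ, s * (9 / 10 : ℝ) ^ s)).const_sub 1).mono_left inf_le_left
  have hbounds : ∀ᶠ n in Filter.atTop ⊓ Filter.principal {n : ℕ | Even (r * n) ∧ r + 1 ≤ n},
      80 * r ^ 2 ≤ n ∧ Even (r * n) := by
    rw [Filter.eventually_inf_principal]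
    filter_upwards [Filter.eventually_ge_atTop (80 * r ^ 2)] with n hn h
    exact ⟨hn, h.1⟩
  refine tendsto_of_tendsto_of_tendsto_of_le_of_le' hlim tendsto_const_nhds ?_ ?_
  · filter_upwards [hbounds] with n hn
    exact (regularProportion_bounds hr hn.1 hn.2).1
  · filter_upwards [hbounds] with n hn
    exact (regularProportion_bounds hr hn.1 hn.2).2
end

section
/- Let a be a fixed real number and for each n ≥ 2 let p(n) = (log n + a)/n. Then the probability that the Erdős–Rényi random graph G(n, p(n)) is connected tends to e^{-e^{-a}} as n tends to infinity. -/
open Classical in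
/-- The probability that the Erdős–Rényi random graph `G(n,p)` lies in the event `A`:
each graph `G` on `Fin n` has probability `p^(#edges of G) * (1-p)^((n choose 2) - #edges of G)`. -/
noncomputable def erProb (n : ℕ) (p : ℝ) (A : Set (SimpleGraph (Fin n))) : ℝ :=
  ∑ G : SimpleGraph (Fin n),
    if G ∈ A then p ^ G.edgeSet.ncard * (1 - p) ^ (n.choose 2 - G.edgeSet.ncard) else 0

section Combinatorics

variable {n : ℕ} {p : ℝ}

open Classical in
theorem erProb_eq_sum_filter (A : Set (SimpleGraph (Fin n))) :
    erProb n p A = ∑ G : SimpleGraph (Fin n) with G ∈ A,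
      p ^ G.edgeSet.ncard * (1 - p) ^ (n.choose 2 - G.edgeSet.ncard) :=
  (Finset.sum_filter _ _).symm

theorem erProb_mono (hp0 : 0 ≤ p) (hp1 : p ≤ 1) {A B : Set (SimpleGraph (Fin n))} (h : A ⊆ B) :
    erProb n p A ≤ erProb n p B := by
  have hq : 0 ≤ 1 - p := by linarith
  refine Finset.sum_le_sum fun G _ ↦ ?_
  by_cases hA : G ∈ A
  · simp [hA, h hA]
  · rw [if_neg hA]
    split_ifs <;> positivity

theorem erProb_add_diff {A B : Set (SimpleGraph (Fin n))} (h : A ⊆ B) :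
    erProb n p A + erProb n p (B \ A) = erProb n p B := by
  rw [erProb, erProb, erProb, ← Finset.sum_add_distrib]
  refine Finset.sum_congr rfl fun G _ ↦ ?_
  by_cases hA : G ∈ A
  · simp [hA, h hA]
  · by_cases hB : G ∈ B <;> simp [hA, hB]

theorem erProb_nonneg (hp0 : 0 ≤ p) (hp1 : p ≤ 1) (A : Set (SimpleGraph (Fin n))) :
    0 ≤ erProb n p A := by
  simpa [erProb] using erProb_mono hp0 hp1 (Set.empty_subset A)

theorem erProb_le_sum (hp0 : 0 ≤ p) (hp1 : p ≤ 1) {ι : Type*} (s : Finset ι)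
    {A : Set (SimpleGraph (Fin n))} {B : ι → Set (SimpleGraph (Fin n))}
    (h : ∀ G ∈ A, ∃ i ∈ s, G ∈ B i) :
    erProb n p A ≤ ∑ i ∈ s, erProb n p (B i) := by
  classical
  have hq : 0 ≤ 1 - p := by linarith
  unfold erProb
  rw [Finset.sum_comm]
  refine Finset.sum_le_sum fun G _ ↦ ?_
  have hnn : ∀ i ∈ s, 0 ≤ (if G ∈ B i then
      p ^ G.edgeSet.ncard * (1 - p) ^ (n.choose 2 - G.edgeSet.ncard) else 0) := fun i _ ↦ by
    split_ifs <;> positivity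
  by_cases hA : G ∈ A
  · obtain ⟨i, hi, hG⟩ := h G hA
    refine le_trans ?_ (Finset.single_le_sum hnn hi)
    simp [hA, hG]
  · rw [if_neg hA]
    exact Finset.sum_nonneg hnn

/-- The probability that `G(n,p)` avoids a given set of `m` potential edges is `(1-p)^m`. -/
theorem erProb_disjoint (F : Finset (Sym2 (Fin n))) (hF : ∀ e ∈ F, ¬ e.IsDiag) :
    erProb n p {G | ∀ e ∈ F, e ∉ G.edgeSet} = (1 - p) ^ F.card := by
  classical
  set E : Finset (Sym2 (Fin n)) := (⊤ : SimpleGraph (Fin n)).edgeFinset with hE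
  have memE : ∀ e, e ∈ E ↔ ¬ e.IsDiag := fun e ↦ by simp [hE]
  have cardE : E.card = n.choose 2 := by
    rw [hE, SimpleGraph.card_edgeFinset_top_eq_card_choose_two, Fintype.card_fin]
  have hFE : F ⊆ E := fun e he ↦ (memE e).2 (hF e he)
  have hcard : (E \ F).card + F.card = n.choose 2 := by
    rw [← cardE]; exact Finset.card_sdiff_add_card_eq_card hFE
  have key : erProb n p {G | ∀ e ∈ F, e ∉ G.edgeSet} =
      ∑ T ∈ (E \ F).powerset, p ^ T.card * (1 - p) ^ (n.choose 2 - T.card) := by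
    rw [erProb_eq_sum_filter]
    refine Finset.sum_bij' (fun G _ ↦ G.edgeFinset)
      (fun T _ ↦ SimpleGraph.fromEdgeSet (T : Set (Sym2 (Fin n)))) ?_ ?_ ?_ ?_ ?_
    · intro G hG
      simp only [Finset.mem_filter, Finset.mem_univ, true_and, Set.mem_ofPred_eq] at hG
      simp only [Finset.mem_powerset]
      intro e he
      rw [SimpleGraph.mem_edgeFinset] at he
      exact Finset.mem_sdiff.2 ⟨(memE e).2 (G.not_isDiag_of_mem_edgeSet he),
        fun h ↦ hG e h he⟩
    · intro T hT
      simp only [Finset.mem_powerset] at hT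
      simp only [Finset.mem_filter, Finset.mem_univ, true_and, Set.mem_ofPred_eq,
        SimpleGraph.edgeSet_fromEdgeSet]
      exact fun e he h ↦ (Finset.mem_sdiff.1 (hT h.1)).2 he
    · intro G hG
      simp
    · intro T hT
      simp only [Finset.mem_powerset] at hT
      ext e
      simp only [SimpleGraph.mem_edgeFinset, SimpleGraph.edgeSet_fromEdgeSet]
      constructor
      · exact fun h ↦ h.1
      · exact fun h ↦ ⟨h, by simpa using (memE e).1 (Finset.mem_sdiff.1 (hT h)).1⟩
    · intro G hG
      rw [← SimpleGraph.coe_edgeFinset, Set.ncard_coe_finset]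
  rw [key]
  calc _ = ∑ T ∈ (E \ F).powerset,
        (1 - p) ^ F.card * (p ^ T.card * (1 - p) ^ ((E \ F).card - T.card)) := by
        refine Finset.sum_congr rfl fun T hT ↦ ?_
        have hT' : T.card ≤ (E \ F).card := Finset.card_le_card (Finset.mem_powerset.1 hT)
        have : n.choose 2 - T.card = F.card + ((E \ F).card - T.card) := by omega
        rw [this, pow_add]; ring
    _ = _ := by
        rw [← Finset.mul_sum, Finset.sum_pow_mul_eq_add_pow]; simp

/-- The probability that `G(n,p)` contains one given edge and avoids `m` others. -/
theorem erProb_mem_and_disjoint (F : Finset (Sym2 (Fin n))) (hF : ∀ e ∈ F, ¬ e.IsDiag)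
    (e : Sym2 (Fin n)) (he : ¬ e.IsDiag) (heF : e ∉ F) :
    erProb n p {G | e ∈ G.edgeSet ∧ ∀ f ∈ F, f ∉ G.edgeSet} = p * (1 - p) ^ F.card := by
  classical
  have h1 := erProb_disjoint (p := p) F hF
  have h2 := erProb_disjoint (p := p) (insert e F) (by simpa [he] using hF)
  rw [Finset.card_insert_of_notMem heF, pow_succ] at h2
  have h3 := erProb_add_diff (n := n) (p := p) (A := {G | ∀ f ∈ insert e F, f ∉ G.edgeSet})
    (B := {G | ∀ f ∈ F, f ∉ G.edgeSet}) (fun G hG f hf ↦ hG f (Finset.mem_insert_of_mem hf))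
  have h4 : ({G | ∀ f ∈ F, f ∉ G.edgeSet} \ {G | ∀ f ∈ insert e F, f ∉ G.edgeSet} :
      Set (SimpleGraph (Fin n))) = {G | e ∈ G.edgeSet ∧ ∀ f ∈ F, f ∉ G.edgeSet} := by
    ext G
    simp only [Set.mem_sdiff, Set.mem_ofPred_eq, Finset.mem_insert, forall_eq_or_imp]
    tauto
  rw [h4, h1, h2] at h3
  linarith

/-- The probability that all vertices of a given `k`-set are isolated in `G(n,p)`. -/
theorem erProb_isolated (S : Finset (Fin n)) :
    erProb n p {G | ∀ v ∈ S, ∀ w, ¬ G.Adj v w} =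
      (1 - p) ^ (n.choose 2 - (n - S.card).choose 2) := by
  classical
  set E : Finset (Sym2 (Fin n)) := (⊤ : SimpleGraph (Fin n)).edgeFinset with hE
  have memE : ∀ e, e ∈ E ↔ ¬ e.IsDiag := fun e ↦ by simp [hE]
  have cardE : E.card = n.choose 2 := by
    rw [hE, SimpleGraph.card_edgeFinset_top_eq_card_choose_two, Fintype.card_fin]
  set I : Finset (Sym2 (Fin n)) := Sᶜ.offDiag.image Sym2.mk.uncurry with hI
  have hIE : I ⊆ E := by
    intro e he
    rw [hI, Finset.mem_image] at he
    obtain ⟨⟨v, w⟩, hvw, rfl⟩ := he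
    rw [memE]
    simpa using (Finset.mem_offDiag.1 hvw).2.2
  have hIc : I.card = (n - S.card).choose 2 := by
    rw [hI, Sym2.card_image_offDiag, Finset.card_compl, Fintype.card_fin]
  have := erProb_disjoint (p := p) (E \ I)
    (fun e he ↦ (memE e).1 (Finset.mem_sdiff.1 he).1)
  rw [Finset.card_sdiff_of_subset hIE, cardE, hIc] at this
  rw [← this]
  congr 1
  ext G
  simp only [Set.mem_ofPred_eq, Finset.mem_sdiff, memE]
  constructor
  · intro h e
    induction e with | _ v w
    intro ⟨hd, hn⟩ hadj
    rw [SimpleGraph.mem_edgeSet] at hadj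
    refine hn (Finset.mem_image.2 ⟨(v, w), ?_, rfl⟩)
    simp only [Finset.mem_offDiag, Finset.mem_compl]
    exact ⟨fun hv ↦ h v hv w hadj, fun hw ↦ h w hw v hadj.symm, hadj.ne⟩
  · intro h v hv w hadj
    refine h s(v, w) ⟨by simpa using hadj.ne, fun hmem ↦ ?_⟩ hadj
    rw [hI, Finset.mem_image] at hmem
    obtain ⟨⟨x, y⟩, hxy, heq⟩ := hmem
    simp only [Finset.mem_offDiag, Finset.mem_compl] at hxy
    simp only [Function.uncurry_apply_pair, Sym2.eq_iff] at heq
    rcases heq with ⟨rfl, rfl⟩ | ⟨rfl, rfl⟩ <;> tauto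

/-- Inclusion–exclusion for the absence of isolated vertices. -/
theorem erProb_forall_exists_adj :
    erProb n p {G | ∀ v, ∃ w, G.Adj v w} =
      ∑ k ∈ Finset.range (n + 1),
        (-1) ^ k * ((n.choose k : ℝ) * (1 - p) ^ (n.choose 2 - (n - k).choose 2)) := by
  classical
  have key : erProb n p {G | ∀ v, ∃ w, G.Adj v w} =
      ∑ S ∈ (Finset.univ : Finset (Fin n)).powerset,
        (-1) ^ S.card * erProb n p {G | ∀ v ∈ S, ∀ w, ¬ G.Adj v w} := by
    unfold erProb
    simp_rw [Finset.mul_sum]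
    rw [Finset.sum_comm]
    refine Finset.sum_congr rfl fun G _ ↦ ?_
    have h := Finset.prod_sub (fun _ : Fin n ↦ (1 : ℝ))
      (fun v ↦ if ∀ w, ¬ G.Adj v w then (1 : ℝ) else 0) Finset.univ
    have h1 : ∏ v : Fin n, ((1 : ℝ) - if ∀ w, ¬ G.Adj v w then (1 : ℝ) else 0) =
        if ∀ v, ∃ w, G.Adj v w then 1 else 0 := by
      have : ∀ v : Fin n, ((1 : ℝ) - if ∀ w, ¬ G.Adj v w then (1 : ℝ) else 0) =
          if ∃ w, G.Adj v w then 1 else 0 := by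
        intro v
        by_cases hv : ∃ w, G.Adj v w
        · rw [if_pos hv, if_neg (by push Not; exact hv)]; norm_num
        · rw [if_neg hv, if_pos (by push Not at hv; exact hv)]; norm_num
      simp_rw [this]
      rw [Finset.prod_ite_zero]
      simp
    simp_rw [Finset.prod_ite_zero, Finset.prod_const_one, mul_one] at h
    rw [h1] at h
    calc _ = (if ∀ v, ∃ w, G.Adj v w then (1 : ℝ) else 0) *
          (p ^ G.edgeSet.ncard * (1 - p) ^ (n.choose 2 - G.edgeSet.ncard)) := by
          simp
      _ = _ := by
          rw [h, Finset.sum_mul]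
          refine Finset.sum_congr rfl fun S _ ↦ ?_
          simp
  rw [key]
  simp_rw [erProb_isolated]
  rw [Finset.sum_powerset_apply_card
    (fun k ↦ (-1 : ℝ) ^ k * (1 - p) ^ (n.choose 2 - (n - k).choose 2))]
  simp only [Finset.card_univ, Fintype.card_fin, nsmul_eq_mul]
  exact Finset.sum_congr rfl fun k _ ↦ by ring

/-- The probability that `G(n,p)` has an edge inside a given set, but none leaving it. -/
theorem erProb_adj_and_closed (S : Finset (Fin n)) {v w : Fin n} (hv : v ∈ S) (hw : w ∈ S)
    (hvw : v ≠ w) :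
    erProb n p {G | G.Adj v w ∧ ∀ x ∈ S, ∀ y ∉ S, ¬ G.Adj x y} =
      p * (1 - p) ^ (S.card * (n - S.card)) := by
  classical
  set F : Finset (Sym2 (Fin n)) := (S ×ˢ Sᶜ).image Sym2.mk.uncurry with hF
  have hmem : ∀ x y, s(x, y) ∈ F ↔ (x ∈ S ∧ y ∉ S) ∨ (y ∈ S ∧ x ∉ S) := by
    intro x y
    simp only [hF, Finset.mem_image, Finset.mem_product, Finset.mem_compl, Prod.exists,
      Function.uncurry_apply_pair, Sym2.eq_iff]
    constructor
    · rintro ⟨a, b, h, ⟨rfl, rfl⟩ | ⟨rfl, rfl⟩⟩ <;> tauto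
    · rintro (h | h)
      · exact ⟨x, y, h, by simp⟩
      · exact ⟨y, x, h, by simp⟩
  have hcard : F.card = S.card * (n - S.card) := by
    rw [hF, Finset.card_image_of_injOn, Finset.card_product, Finset.card_compl, Fintype.card_fin]
    rintro ⟨a, b⟩ hab ⟨c, d⟩ hcd heq
    simp only [Finset.coe_product, Set.mem_prod, Finset.mem_coe, Finset.mem_compl] at hab hcd
    simp only [Function.uncurry_apply_pair, Sym2.eq_iff] at heq
    rcases heq with ⟨rfl, rfl⟩ | ⟨rfl, rfl⟩
    · rfl
    · tauto
  rw [← hcard, ← erProb_mem_and_disjoint F _ s(v, w) (by simpa using hvw)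
    (by rw [hmem]; tauto)]
  · congr 1
    ext G
    simp only [Set.mem_ofPred_eq, SimpleGraph.mem_edgeSet]
    refine and_congr_right fun _ ↦ ⟨fun h e ↦ ?_, fun h x hx y hy hadj ↦ ?_⟩
    · induction e with | _ x y
      rw [hmem, SimpleGraph.mem_edgeSet]
      rintro (⟨hx, hy⟩ | ⟨hy, hx⟩) hadj
      · exact h x hx y hy hadj
      · exact h y hy x hx hadj.symm
    · exact h s(x, y) ((hmem x y).2 (Or.inl ⟨hx, hy⟩)) hadj
  · intro e
    induction e with | _ x y
    rw [hmem, Sym2.mk_isDiag_iff]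
    rintro h rfl
    tauto

/-- A disconnected graph has a nonempty set of at most half of the vertices without edges
leaving it. -/
theorem SimpleGraph.exists_closed_of_not_connected (hn : 0 < n) (G : SimpleGraph (Fin n))
    (hG : ¬ G.Connected) :
    ∃ S : Finset (Fin n), S.Nonempty ∧ 2 * S.card ≤ n ∧ ∀ x ∈ S, ∀ y ∉ S, ¬ G.Adj x y := by
  classical
  have : Nonempty (Fin n) := ⟨⟨0, hn⟩⟩
  have : ¬ G.Preconnected := fun h ↦ hG ⟨h⟩
  simp only [SimpleGraph.Preconnected, not_forall] at this
  obtain ⟨u, v, huv⟩ := this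
  set T : Finset (Fin n) := Finset.univ.filter (G.Reachable u) with hT
  have hTc : ∀ x ∈ T, ∀ y ∉ T, ¬ G.Adj x y := by
    intro x hx y hy hadj
    simp only [hT, Finset.mem_filter, Finset.mem_univ, true_and] at hx hy
    exact hy (hx.trans hadj.reachable)
  by_cases h : 2 * T.card ≤ n
  · exact ⟨T, ⟨u, by simp [hT]⟩, h, hTc⟩
  · refine ⟨Tᶜ, ⟨v, by simpa [hT] using huv⟩, ?_, fun x hx y hy hadj ↦ ?_⟩
    · rw [Finset.card_compl, Fintype.card_fin]; omega
    · exact hTc y (by simpa using hy) x (by simpa using hx) hadj.symm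

/-- A first moment bound for disconnected graphs without isolated vertices. -/
theorem erProb_not_connected_le (hn : 0 < n) (hp0 : 0 ≤ p) (hp1 : p ≤ 1) :
    erProb n p ({G | ∀ v, ∃ w, G.Adj v w} \ {G | G.Connected}) ≤
      ∑ k ∈ Finset.range (n + 1), if 2 * k ≤ n then
        (n.choose k : ℝ) * ((k : ℝ) ^ 2 * (p * (1 - p) ^ (k * (n - k)))) else 0 := by
  classical
  have hq : 0 ≤ 1 - p := by linarith
  calc _ ≤ ∑ S ∈ (Finset.univ : Finset (Fin n)).powerset with 2 * S.card ≤ n,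
        erProb n p {G | ∃ v ∈ S, ∃ w ∈ S, G.Adj v w ∧ ∀ x ∈ S, ∀ y ∉ S, ¬ G.Adj x y} := by
        refine erProb_le_sum hp0 hp1 _ fun G hG ↦ ?_
        obtain ⟨S, ⟨v, hv⟩, hS, hc⟩ := G.exists_closed_of_not_connected hn hG.2
        obtain ⟨w, hw⟩ := hG.1 v
        exact ⟨S, by simpa using hS, v, hv, w, by_contra fun h ↦ hc v hv w h hw, hw, hc⟩
    _ ≤ ∑ S ∈ (Finset.univ : Finset (Fin n)).powerset with 2 * S.card ≤ n,
        (S.card : ℝ) ^ 2 * (p * (1 - p) ^ (S.card * (n - S.card))) := by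
        refine Finset.sum_le_sum fun S _ ↦ ?_
        calc _ ≤ ∑ x ∈ S.offDiag,
              erProb n p {G | G.Adj x.1 x.2 ∧ ∀ x ∈ S, ∀ y ∉ S, ¬ G.Adj x y} := by
              refine erProb_le_sum hp0 hp1 _ ?_
              rintro G ⟨v, hv, w, hw, hadj, hc⟩
              exact ⟨(v, w), Finset.mem_offDiag.2 ⟨hv, hw, hadj.ne⟩, hadj, hc⟩
          _ = ∑ x ∈ S.offDiag, p * (1 - p) ^ (S.card * (n - S.card)) := by
              refine Finset.sum_congr rfl fun x hx ↦ ?_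
              obtain ⟨h1, h2, h3⟩ := Finset.mem_offDiag.1 hx
              exact erProb_adj_and_closed S h1 h2 h3
          _ ≤ _ := by
              rw [Finset.sum_const, nsmul_eq_mul]
              refine mul_le_mul_of_nonneg_right ?_ (by positivity)
              rw [Finset.offDiag_card, sq]
              exact_mod_cast Nat.sub_le _ _
    _ = _ := by
        rw [Finset.sum_filter, Finset.sum_powerset_apply_card (fun k ↦ if 2 * k ≤ n then
          (k : ℝ) ^ 2 * (p * (1 - p) ^ (k * (n - k))) else 0)]
        simp only [Finset.card_univ, Fintype.card_fin, nsmul_eq_mul, mul_ite, mul_zero]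

end Combinatorics

section Analysis

open Filter Topology

theorem tendsto_sum_range_of_dominated {f : ℕ → ℕ → ℝ} {g bound : ℕ → ℝ} (hb : Summable bound)
    (hb0 : ∀ k, 0 ≤ bound k) (h : ∀ k, Tendsto (fun n ↦ f n k) atTop (𝓝 (g k)))
    (hbd : ∀ᶠ n in atTop, ∀ k ≤ n, |f n k| ≤ bound k) :
    Tendsto (fun n ↦ ∑ k ∈ Finset.range (n + 1), f n k) atTop (𝓝 (∑' k, g k)) := by
  have := tendsto_tsum_of_dominated_convergence (𝓕 := atTop)
    (f := fun n k ↦ if k ≤ n then f n k else 0) hb (fun k ↦ (h k).congr' ?_) ?_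
  · refine this.congr fun n ↦ ?_
    rw [tsum_eq_sum (s := Finset.range (n + 1))]
    · refine Finset.sum_congr rfl fun k hk ↦ if_pos ?_
      have := Finset.mem_range.1 hk
      omega
    · intro k hk
      refine if_neg fun hk' ↦ hk (Finset.mem_range.2 ?_)
      omega
  · filter_upwards [eventually_ge_atTop k] with n hn
    rw [if_pos hn]
  · filter_upwards [hbd] with n hn k
    by_cases hk : k ≤ n
    · simpa [hk] using hn k hk
    · simpa [hk] using hb0 k

theorem natCast_mul_log_le_add_log_factorial (k : ℕ) :
    (k : ℝ) * Real.log k ≤ k + Real.log k.factorial := by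
  rcases Nat.eq_zero_or_pos k with rfl | hk
  · simp
  have hk' : (0 : ℝ) < k := by exact_mod_cast hk
  have hf : (0 : ℝ) < k.factorial := by exact_mod_cast k.factorial_pos
  have h := Real.log_le_log (by positivity) (Real.pow_div_factorial_le_exp _ hk'.le k)
  rw [Real.log_exp, Real.log_div (by positivity) hf.ne', Real.log_pow] at h
  linarith

theorem summable_exp_mul_half_log_div_factorial (C : ℝ) :
    Summable fun k : ℕ ↦ Real.exp (k * (Real.log k / 2 + C)) / k.factorial := by
  have hs : Summable fun k : ℕ ↦ Real.exp (k * (C + 1 / 2) - Real.log k.factorial / 2) := by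
    refine summable_of_ratio_test_tendsto_lt_one (l := 0) one_pos
      (Eventually.of_forall fun k ↦ (Real.exp_pos _).ne') ?_
    have : Tendsto (fun k : ℕ ↦ Real.exp (-(Real.log ((k + 1 : ℕ) : ℝ) / 2 - (C + 1 / 2))))
        atTop (𝓝 0) := by
      refine Real.tendsto_exp_neg_atTop_nhds_zero.comp ?_
      refine tendsto_atTop_add_const_right _ _ (Tendsto.atTop_div_const two_pos ?_)
      exact Real.tendsto_log_atTop.comp
        (tendsto_natCast_atTop_atTop.comp (tendsto_add_atTop_nat 1))
    refine this.congr fun k ↦ ?_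
    rw [Real.norm_of_nonneg (Real.exp_pos _).le, Real.norm_of_nonneg (Real.exp_pos _).le,
      ← Real.exp_sub, Nat.factorial_succ, Nat.cast_mul, Real.log_mul (by positivity)
        (by exact_mod_cast k.factorial_ne_zero)]
    congr 1
    push_cast
    ring
  refine Summable.of_nonneg_of_le (fun k ↦ by positivity) (fun k ↦ ?_) hs
  have hf : (0 : ℝ) < k.factorial := by exact_mod_cast k.factorial_pos
  have h := natCast_mul_log_le_add_log_factorial k
  calc _ = Real.exp (k * (Real.log k / 2 + C) - Real.log k.factorial) := by
        rw [Real.exp_sub, Real.exp_log hf]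
    _ ≤ _ := Real.exp_le_exp.2 (by nlinarith)

theorem natCast_mul_log_le {k n : ℕ} (hn : 0 < n) (hk : k ≤ n) :
    (k : ℝ) * Real.log n ≤ n * (Real.log k + 1) := by
  have hn' : (0 : ℝ) < n := by exact_mod_cast hn
  rcases Nat.eq_zero_or_pos k with rfl | hk0
  · simp
  have hk' : (0 : ℝ) < k := by exact_mod_cast hk0
  have hkn : (k : ℝ) ≤ n := by exact_mod_cast hk
  have h1 := Real.log_le_sub_one_of_pos (div_pos hn' hk')
  rw [Real.log_div hn'.ne' hk'.ne'] at h1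
  have h2 : 0 ≤ Real.log k := Real.log_natCast_nonneg k
  have h3 : (k : ℝ) * (Real.log n - Real.log k) ≤ k * (n / k - 1) :=
    mul_le_mul_of_nonneg_left h1 hk'.le
  have h4 : (k : ℝ) * (n / k - 1) = n - k := by field_simp
  nlinarith

theorem choose_mul_pow_le {a y : ℝ} {n k m : ℕ} (hn : 0 < n) (hp0 : 0 ≤ (Real.log n + a) / n)
    (hp1 : (Real.log n + a) / n ≤ 1) (hm : k * (n - y) ≤ m) (hy0 : 0 ≤ y) (hyn : y ≤ n)
    (hy : y * Real.log n ≤ n * (Real.log k / 2 + 2)) :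
    (n.choose k : ℝ) * (1 - (Real.log n + a) / n) ^ m ≤
      Real.exp (k * (Real.log k / 2 + (2 + 2 * |a|))) / k.factorial := by
  have hn' : (0 : ℝ) < n := by exact_mod_cast hn
  set p := (Real.log n + a) / n with hp
  have hpn : p * n = Real.log n + a := by rw [hp]; field_simp
  have hpy : p * y ≤ Real.log k / 2 + 2 + |a| := by
    rw [hp, div_mul_eq_mul_div, div_le_iff₀ hn']
    have : a * y ≤ |a| * n :=
      (mul_le_mul_of_nonneg_right (le_abs_self a) hy0).trans
        (mul_le_mul_of_nonneg_left hyn (abs_nonneg a))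
    nlinarith
  have hq : (1 - p) ^ m ≤ Real.exp (-(p * (k * (n - y)))) := by
    calc (1 - p) ^ m ≤ Real.exp (-p) ^ m :=
          pow_le_pow_left₀ (by linarith) (Real.one_sub_le_exp_neg p) m
      _ = Real.exp (-(p * m)) := by rw [← Real.exp_nat_mul]; congr 1; ring
      _ ≤ _ := Real.exp_le_exp.2 (neg_le_neg (mul_le_mul_of_nonneg_left hm hp0))
  have hnk : (n : ℝ) ^ k = Real.exp (k * Real.log n) := by
    rw [Real.exp_nat_mul, Real.exp_log hn']
  calc _ ≤ (n : ℝ) ^ k / k.factorial * Real.exp (-(p * (k * (n - y)))) :=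
        mul_le_mul (Nat.choose_le_pow_div k n) hq (pow_nonneg (by linarith) _) (by positivity)
    _ = Real.exp (k * (Real.log n - p * n + p * y)) / k.factorial := by
        rw [hnk, div_mul_eq_mul_div, ← Real.exp_add]
        congr 2
        ring
    _ ≤ _ := by
        have : Real.log n - p * n + p * y ≤ Real.log k / 2 + (2 + 2 * |a|) := by
          linarith [neg_abs_le a]
        gcongr

variable (a : ℝ)

theorem tendsto_log_add_sq_div_atTop :
    Tendsto (fun n : ℕ ↦ (Real.log n + a) ^ 2 / n) atTop (𝓝 0) := by
  have h2 := (Real.tendsto_pow_log_div_mul_add_atTop 1 0 2 one_ne_zero).comp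
    tendsto_natCast_atTop_atTop
  have h1 := (Real.tendsto_pow_log_div_mul_add_atTop 1 0 1 one_ne_zero).comp
    tendsto_natCast_atTop_atTop
  have h0 := (Real.tendsto_pow_log_div_mul_add_atTop 1 0 0 one_ne_zero).comp
    tendsto_natCast_atTop_atTop
  have := (h2.add (h1.const_mul (2 * a))).add (h0.const_mul (a ^ 2))
  simp only [mul_zero, add_zero] at this
  refine this.congr fun n ↦ ?_
  simp only [Function.comp_apply]
  ring

theorem tendsto_log_add_div_atTop :
    Tendsto (fun n : ℕ ↦ (Real.log n + a) / n) atTop (𝓝 0) := by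
  have h1 := (Real.tendsto_pow_log_div_mul_add_atTop 1 0 1 one_ne_zero).comp
    tendsto_natCast_atTop_atTop
  have h0 := (Real.tendsto_pow_log_div_mul_add_atTop 1 0 0 one_ne_zero).comp
    tendsto_natCast_atTop_atTop
  have := h1.add (h0.const_mul a)
  simp only [mul_zero, add_zero] at this
  refine this.congr fun n ↦ ?_
  simp only [Function.comp_apply]
  ring

theorem eventually_log_add_div_mem :
    ∀ᶠ n : ℕ in atTop, 0 ≤ (Real.log n + a) / n ∧ (Real.log n + a) / n < 1 := by
  filter_upwards [(tendsto_log_add_div_atTop a).eventually_lt_const one_pos,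
    (Real.tendsto_log_atTop.comp tendsto_natCast_atTop_atTop).eventually_ge_atTop (-a)]
    with n h1 h2
  simp only [Function.comp_apply] at h2
  exact ⟨div_nonneg (by linarith) n.cast_nonneg, h1⟩

theorem tendsto_natCast_mul_one_sub_pow :
    Tendsto (fun n : ℕ ↦ (n : ℝ) * (1 - (Real.log n + a) / n) ^ n) atTop
      (𝓝 (Real.exp (-a))) := by
  have hlow : Tendsto (fun n : ℕ ↦ -a - (Real.log n + a) ^ 2 / n / (1 - (Real.log n + a) / n))
      atTop (𝓝 (-a)) := by
    have := ((tendsto_log_add_sq_div_atTop a).div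
      ((tendsto_log_add_div_atTop a).const_sub 1) (by norm_num)).const_sub (-a)
    simpa using this
  have hlog : Tendsto (fun n : ℕ ↦ Real.log n + n * Real.log (1 - (Real.log n + a) / n)) atTop
      (𝓝 (-a)) := by
    refine tendsto_of_tendsto_of_tendsto_of_le_of_le' hlow tendsto_const_nhds ?_ ?_
    · filter_upwards [eventually_log_add_div_mem a, eventually_gt_atTop 0] with n ⟨_, h1⟩ hn
      have hn' : (0 : ℝ) < n := by exact_mod_cast hn
      set p := (Real.log n + a) / n with hp
      have hpn : Real.log n + a = p * n := by rw [hp]; field_simp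
      have hq : 0 < 1 - p := by linarith
      have h := mul_le_mul_of_nonneg_left (Real.one_sub_inv_le_log_of_pos hq) hn'.le
      have : -a - (Real.log n + a) ^ 2 / n / (1 - p) = Real.log n + n * (1 - (1 - p)⁻¹) := by
        rw [hpn, show Real.log n = p * n - a by linarith]
        field_simp
        ring
      rw [this]
      linarith
    · filter_upwards [eventually_log_add_div_mem a, eventually_gt_atTop 0] with n ⟨_, h1⟩ hn
      have hn' : (0 : ℝ) < n := by exact_mod_cast hn
      set p := (Real.log n + a) / n with hp
      have hpn : Real.log n + a = n * p := by rw [hp]; field_simp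
      have hq : 0 < 1 - p := by linarith
      have h := mul_le_mul_of_nonneg_left (Real.log_le_sub_one_of_pos hq) hn'.le
      linarith
  refine (hlog.rexp).congr' ?_
  filter_upwards [eventually_log_add_div_mem a, eventually_gt_atTop 0] with n ⟨_, h1⟩ hn
  rw [Real.exp_add, Real.exp_log (by exact_mod_cast hn), Real.exp_nat_mul,
    Real.exp_log (by linarith)]

theorem tendsto_choose_mul_one_sub_pow {k c : ℕ} {m : ℕ → ℕ}
    (hm : ∀ᶠ n in atTop, m n + c = n * k) :
    Tendsto (fun n : ℕ ↦ (n.choose k : ℝ) * (1 - (Real.log n + a) / n) ^ m n) atTop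
      (𝓝 (Real.exp (-a) ^ k / k.factorial)) := by
  have h1 := ProbabilityTheory.tendsto_choose_mul_pow_atTop k (tendsto_natCast_mul_one_sub_pow a)
  have h2 := ((tendsto_log_add_div_atTop a).const_sub 1).pow c
  have h := h1.div h2 (by norm_num)
  simp only [sub_zero, one_pow, div_one] at h
  refine h.congr' ?_
  filter_upwards [hm, eventually_log_add_div_mem a] with n hn ⟨_, hp⟩
  have hq : 0 < 1 - (Real.log n + a) / n := by linarith
  rw [Pi.div_apply, ← pow_mul, ← hn, pow_add]
  field_simp

theorem choose_two_sub_choose_two_add {n k : ℕ} (hk : k ≤ n) :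
    n.choose 2 - (n - k).choose 2 + (k + 1).choose 2 = n * k := by
  obtain ⟨j, rfl⟩ := Nat.exists_eq_add_of_le' hk
  have h : (j + k).choose 2 + (k + 1).choose 2 = (j + k) * k + j.choose 2 := by
    have : (((j + k).choose 2 + (k + 1).choose 2 : ℕ) : ℝ) = ((j + k) * k + j.choose 2 : ℕ) := by
      push_cast [Nat.cast_choose_two]
      ring
    exact_mod_cast this
  have h' : j.choose 2 ≤ (j + k).choose 2 := Nat.choose_le_choose 2 (Nat.le_add_right j k)
  rw [Nat.add_sub_cancel]
  omega

theorem tendsto_erProb_forall_exists_adj :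
    Tendsto (fun n : ℕ ↦ erProb n ((Real.log n + a) / n) {G | ∀ v, ∃ w, G.Adj v w}) atTop
      (𝓝 (Real.exp (-Real.exp (-a)))) := by
  simp_rw [erProb_forall_exists_adj]
  have hsum : ∑' k : ℕ, (-1) ^ k * (Real.exp (-a) ^ k / k.factorial) =
      Real.exp (-Real.exp (-a)) := by
    rw [Real.exp_eq_exp_ℝ, ← (NormedSpace.expSeries_div_hasSum_exp (-NormedSpace.exp (-a))).tsum_eq]
    refine tsum_congr fun k ↦ ?_
    rw [neg_pow (NormedSpace.exp (-a))]
    ring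
  rw [← hsum]
  refine tendsto_sum_range_of_dominated (summable_exp_mul_half_log_div_factorial (2 + 2 * |a|))
    (fun k ↦ by positivity) (fun k ↦ ?_) ?_
  · refine (tendsto_choose_mul_one_sub_pow a (c := (k + 1).choose 2) ?_).const_mul _
    filter_upwards [eventually_ge_atTop k] with n hn using choose_two_sub_choose_two_add hn
  · filter_upwards [eventually_log_add_div_mem a, eventually_gt_atTop 0] with n ⟨hp0, hp1⟩ hn k hk
    have hn1 : (1 : ℝ) ≤ n := by exact_mod_cast hn
    have hkn : (k : ℝ) ≤ n := by exact_mod_cast hk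
    rw [abs_mul, abs_pow, abs_neg, abs_one, one_pow, one_mul,
      abs_of_nonneg (mul_nonneg (Nat.cast_nonneg _) (pow_nonneg (by linarith) _))]
    refine choose_mul_pow_le (y := (k + 1) / 2) hn hp0 hp1.le ?_ (by positivity) (by linarith) ?_
    · have h := congrArg (Nat.cast : ℕ → ℝ) (choose_two_sub_choose_two_add hk)
      rw [Nat.cast_add, Nat.cast_mul, Nat.cast_choose_two ℝ (k + 1)] at h
      push_cast at h ⊢
      linarith
    · have h1 := natCast_mul_log_le hn hk
      have h2 := Real.log_le_sub_one_of_pos (zero_lt_one.trans_le hn1)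
      linarith

theorem tendsto_sum_disconnected :
    Tendsto (fun n : ℕ ↦ ∑ k ∈ Finset.range (n + 1), if 2 * k ≤ n then
      (n.choose k : ℝ) * ((k : ℝ) ^ 2 * ((Real.log n + a) / n *
        (1 - (Real.log n + a) / n) ^ (k * (n - k)))) else 0) atTop (𝓝 0) := by
  suffices h : Tendsto _ atTop (𝓝 (∑' _ : ℕ, (0 : ℝ))) by rwa [tsum_zero] at h
  refine tendsto_sum_range_of_dominated
    (summable_exp_mul_half_log_div_factorial (2 + 2 * |a| + 2))
    (fun k ↦ by positivity) (fun k ↦ ?_) ?_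
  · have h := (((tendsto_choose_mul_one_sub_pow a (k := k) (c := k * k)
      (m := fun n ↦ k * (n - k)) ?_).mul (tendsto_log_add_div_atTop a)).mul_const ((k : ℝ) ^ 2))
    · rw [mul_zero, zero_mul] at h
      refine h.congr' ?_
      filter_upwards [eventually_ge_atTop (2 * k)] with n hn
      rw [if_pos hn]
      ring
    · filter_upwards [eventually_ge_atTop k] with n hn
      rw [← mul_add, Nat.sub_add_cancel hn, mul_comm]
  · filter_upwards [eventually_log_add_div_mem a, eventually_gt_atTop 0] with n ⟨hp0, hp1⟩ hn k hk
    split_ifs with h2k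
    swap
    · rw [abs_zero]; positivity
    have hkn : (k : ℝ) ≤ n := by exact_mod_cast hk
    have hb := choose_mul_pow_le (y := k) (k := k) (m := k * (n - k)) hn hp0 hp1.le
      (by push_cast [Nat.cast_sub hk]; exact le_rfl) (by positivity) hkn ?_
    · have hq : 0 ≤ (1 - (Real.log n + a) / n) ^ (k * (n - k)) := pow_nonneg (by linarith) _
      rw [abs_of_nonneg (by positivity)]
      have hk2 : (k : ℝ) ^ 2 ≤ Real.exp (k * 2) := by
        rw [mul_two, Real.exp_add, sq]
        exact mul_self_le_mul_self k.cast_nonneg (by linarith [Real.add_one_le_exp (k : ℝ)])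
      calc _ = (k : ℝ) ^ 2 * ((Real.log n + a) / n) *
            (n.choose k * (1 - (Real.log n + a) / n) ^ (k * (n - k))) := by ring
        _ ≤ Real.exp (k * 2) * 1 *
            (Real.exp (k * (Real.log k / 2 + (2 + 2 * |a|))) / k.factorial) := by gcongr
        _ = _ := by
            rw [mul_one, mul_div_assoc', ← Real.exp_add]
            congr 2
            ring
    · rcases Nat.eq_zero_or_pos k with rfl | hk0
      · simp
      have h := natCast_mul_log_le hn h2k
      have hl : Real.log 2 ≤ 1 := by linarith [Real.log_two_lt_d9]
      push_cast at h
      rw [Real.log_mul two_ne_zero (by positivity)] at h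
      have hn' : (0 : ℝ) < n := by exact_mod_cast hn
      nlinarith

end Analysis

/-- For fixed `a : ℝ` and `p n = (log n + a) / n`, the probability that `G(n, p n)` is
connected tends to `exp (-exp (-a))`. -/
theorem er_connected_prob_tendsto (a : ℝ) :
    Filter.Tendsto
      (fun n : ℕ => erProb n ((Real.log n + a) / n) {G | G.Connected})
      Filter.atTop (nhds (Real.exp (-Real.exp (-a)))) := by
  have hiso := tendsto_erProb_forall_exists_adj a
  have hdiff : Filter.Tendsto (fun n : ℕ ↦ erProb n ((Real.log n + a) / n)
      ({G | ∀ v, ∃ w, G.Adj v w} \ {G | G.Connected})) Filter.atTop (nhds 0) := by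
    refine squeeze_zero' ?_ ?_ (tendsto_sum_disconnected a)
    · filter_upwards [eventually_log_add_div_mem a] with n hp
      exact erProb_nonneg hp.1 hp.2.le _
    · filter_upwards [eventually_log_add_div_mem a, Filter.eventually_gt_atTop 0] with n hp hn
      exact erProb_not_connected_le hn hp.1 hp.2.le
  have h := hiso.sub hdiff
  rw [sub_zero] at h
  refine h.congr' ?_
  filter_upwards [Filter.eventually_ge_atTop 2] with n hn
  have : Nontrivial (Fin n) := Fin.nontrivial_iff_two_le.2 hn
  rw [← erProb_add_diff (A := {G : SimpleGraph (Fin n) | G.Connected})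
    (B := {G | ∀ v, ∃ w, G.Adj v w}), add_sub_cancel_right]
  exact fun G hG v ↦ hG.preconnected.exists_adj_of_nontrivial v
end
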